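/- Fix ε > 0. Let τ = log log D − 2 log log log D and let Φ_D(τ) denote the proportion of fundamental discriminants d with d ≤ D for which L(1, χ_d) ≥ e^γ · τ, where γ is the Euler–Mascheroni constant. Then for all sufficiently large D one has Φ_D(τ) ≥ D^{−ε}. -/

import Mathlib

open Filter

/-- The Dirichlet L-function of `χ` (extended by `0` for modulus `0`). -/
noncomputable def LFun (d : ℕ) (χ : DirichletCharacter ℂ d) (s : ℂ) : ℂ :=
  if h : d ≠ 0 then
    letI : NeZero d := ⟨h⟩
    DirichletCharacter.LFunction χ s
  else 0

/-- `𝓛_χ = Σ_p χ(p)/p` has value `L`: the partial sums over primes `p < y`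
converge to `L` as `y → ∞`. -/
def HasCurlyL {d : ℕ} (χ : DirichletCharacter ℂ d) (L : ℝ) : Prop :=
  Filter.Tendsto
    (fun y : ℕ => ∑ p ∈ (Finset.range y).filter Nat.Prime, (χ p).re / (p : ℝ))
    Filter.atTop (nhds L)

/-- Number of ordered pairs `(p, q)` of primes with `p * q ≤ x` satisfying `P p q`. -/
noncomputable def pairCount (x : ℝ) (P : ℕ → ℕ → Prop) : ℕ :=
  Nat.card {pq : ℕ × ℕ // pq.1.Prime ∧ pq.2.Prime ∧ ((pq.1 * pq.2 : ℕ) : ℝ) ≤ x ∧ P pq.1 pq.2}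

/-- The race ratio `#{pq ≤ x : χ(p) = χ(q) = η} / ((1/4) #{pq ≤ x : gcd(pq, d) = 1})`,
where products of two primes are counted as ordered pairs. -/
noncomputable def raceRatio {d : ℕ} (χ : DirichletCharacter ℂ d) (η : ℂ) (x : ℝ) : ℝ :=
  (pairCount x (fun p q => χ p = η ∧ χ q = η) : ℝ) /
    ((1 / 4 : ℝ) * (pairCount x (fun p q => Nat.gcd (p * q) d = 1) : ℝ))

/-- A positive integer is a fundamental discriminant if it is `≡ 1 (mod 4)` and squarefree,
or is `4m` with `m ≡ 2, 3 (mod 4)` squarefree. -/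
def IsFundamentalDiscriminant (d : ℕ) : Prop :=
  0 < d ∧ ((d % 4 = 1 ∧ Squarefree d) ∨
    (d % 4 = 0 ∧ Squarefree (d / 4) ∧ (d / 4 % 4 = 2 ∨ d / 4 % 4 = 3)))

/-- The Generalized Riemann Hypothesis for Dirichlet L-functions: all zeros in the
critical strip lie on the critical line. -/
def GRH : Prop :=
  ∀ (d : ℕ), d ≠ 0 → ∀ (χ : DirichletCharacter ℂ d) (s : ℂ),
    LFun d χ s = 0 → 0 < s.re → s.re < 1 → s.re = 1 / 2

/-- `L(s, χ)` has no real zero `β` with `1 - c / log d ≤ β ≤ 1` (a Siegel zero). -/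
def HasNoSiegelZero (c : ℝ) (d : ℕ) (χ : DirichletCharacter ℂ d) : Prop :=
  ¬ ∃ β : ℝ, 1 - c / Real.log d ≤ β ∧ β ≤ 1 ∧ LFun d χ (β : ℂ) = 0

/-- The logarithmic integral `Li(t) = ∫_2^t du / log u`. -/
noncomputable def Li (t : ℝ) : ℝ := ∫ u in (2:ℝ)..t, 1 / Real.log u

open scoped Topology
/-- `phiM x = (1 - e^{-x})/x`. -/
noncomputable def phiM (x : ℝ) : ℝ := ∫ u in (0:ℝ)..1, Real.exp (-(x * u))
noncomputable def PhiM (t : ℝ) : ℝ := ∫ x in (0:ℝ)..t, phiM x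

lemma phiM_continuous : Continuous phiM := by
  unfold phiM
  apply intervalIntegral.continuous_parametric_intervalIntegral_of_continuous'
  fun_prop

lemma phiM_antitone : Antitone phiM := by
  intro x y hxy
  unfold phiM
  apply intervalIntegral.integral_mono_on (by norm_num)
  · apply Continuous.intervalIntegrable; fun_prop
  · apply Continuous.intervalIntegrable; fun_prop
  · intro u hu
    apply Real.exp_le_exp.mpr
    have := mul_le_mul_of_nonneg_right hxy hu.1
    linarith

lemma mul_phiM (x : ℝ) : x * phiM x = 1 - Real.exp (-x) := by
  by_cases hx : x = 0
  · simp [hx]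
  have h : ∀ u ∈ Set.uIcc (0:ℝ) 1, HasDerivAt (fun u => -Real.exp (-(x*u)) / x) (Real.exp (-(x*u))) u := by
    intro u _
    have h1 : HasDerivAt (fun u:ℝ => -(x*u)) (-(x*1)) u := ((hasDerivAt_id u).const_mul x).neg
    have h2 := (h1.exp.neg).div_const x
    refine HasDerivAt.congr_deriv h2 ?_
    rw [div_eq_iff hx]; ring
  have := intervalIntegral.integral_eq_sub_of_hasDerivAt h
    (by apply Continuous.intervalIntegrable; fun_prop)
  unfold phiM
  rw [this]
  field_simp
  simp
  ring

lemma phiM_le_one {x : ℝ} (hx : 0 ≤ x) : phiM x ≤ 1 := by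
  have := phiM_antitone hx
  simpa [phiM] using this

lemma phiM_nonneg (x : ℝ) : 0 ≤ phiM x := by
  unfold phiM
  apply intervalIntegral.integral_nonneg (by norm_num)
  intro u _; positivity

lemma PhiM_hasDerivAt (t : ℝ) : HasDerivAt PhiM (phiM t) t :=
  phiM_continuous.integral_hasStrictDerivAt 0 t |>.hasDerivAt

lemma log_mul_exp_integral :
    MeasureTheory.IntegrableOn (fun t : ℝ => Real.log t * Real.exp (-t)) (Set.Ioi 0) ∧
    ∫ t in Set.Ioi (0:ℝ), Real.log t * Real.exp (-t) = -Real.eulerMascheroniConstant := by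
  have key := mellin_hasDerivAt_of_isBigO_rpow (E := ℂ) (f := fun t : ℝ => ((Real.exp (-t) : ℝ) : ℂ))
    (a := 2) (b := 0) (s := 1) ?_ ?_ (by norm_num) ?_ (by norm_num)
  · obtain ⟨h1, h2⟩ := key
    have e : ∀ t ∈ Set.Ioi (0:ℝ), ((t:ℂ) ^ ((1:ℂ) - 1)) • (Real.log t • ((Real.exp (-t) : ℝ) : ℂ)) =
        ((Real.log t * Real.exp (-t) : ℝ) : ℂ) := by
      intro t ht
      simp
    constructor
    · unfold MellinConvergent at h1
      have h1' := h1.congr_fun e measurableSet_Ioi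
      have := MeasureTheory.Integrable.re h1'
      simpa only [MeasureTheory.IntegrableOn, RCLike.re_to_complex, Complex.ofReal_re] using this
    · have hg : HasDerivAt Complex.Gamma (-(Real.eulerMascheroniConstant:ℂ)) 1 :=
        Complex.hasDerivAt_Gamma_one
      have hI := Complex.hasDerivAt_GammaIntegral (s := 1) (by norm_num)
      have heq : Complex.Gamma =ᶠ[𝓝 1] Complex.GammaIntegral := by
        have : ∀ᶠ s : ℂ in 𝓝 1, 0 < s.re :=
          (isOpen_lt continuous_const Complex.continuous_re).mem_nhds (by simp)
        filter_upwards [this] with s hs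
        exact Complex.Gamma_eq_integral hs
      have := (hI.congr_of_eventuallyEq heq).unique hg
      have h3 : ((∫ t in Set.Ioi (0:ℝ), Real.log t * Real.exp (-t) : ℝ) : ℂ) = -(Real.eulerMascheroniConstant:ℂ) := by
        rw [← this, ← integral_complex_ofReal]
        apply MeasureTheory.setIntegral_congr_fun measurableSet_Ioi
        intro t ht
        simp
      exact_mod_cast h3
  · refine (Continuous.continuousOn ?_).locallyIntegrableOn measurableSet_Ioi
    fun_prop
  · rw [← Asymptotics.isBigO_norm_left]
    simp_rw [Complex.norm_real, Asymptotics.isBigO_norm_left]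
    simpa only [neg_one_mul] using (isLittleO_exp_neg_mul_rpow_atTop zero_lt_one _).isBigO
  · simp only [neg_zero, Real.rpow_zero]
    apply Asymptotics.isBigO_const_of_tendsto (y := (1:ℂ)) _ (by norm_num)
    have : Continuous (fun t : ℝ => ((Real.exp (-t) : ℝ) : ℂ)) := by fun_prop
    have := this.tendsto 0
    simp only [neg_zero, Real.exp_zero, Complex.ofReal_one] at this
    exact this.mono_left nhdsWithin_le_nhds

lemma PhiM_sub_log_tendsto :
    Tendsto (fun t => PhiM t - Real.log t) atTop (𝓝 Real.eulerMascheroniConstant) := by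
  obtain ⟨hIntg, hval⟩ := log_mul_exp_integral
  have h1 := MeasureTheory.intervalIntegral_tendsto_integral_Ioi 0 hIntg tendsto_id
  rw [hval] at h1
  have h2 : ∀ T : ℝ, 0 < T → ∫ t in (0:ℝ)..T, Real.log t * Real.exp (-t) =
      Real.log T - Real.log T * Real.exp (-T) - PhiM T := by
    intro T hT
    have hc : Continuous (fun t => (t * Real.log t) * phiM t - PhiM t) := by
      have a1 := Real.continuous_mul_log
      have a2 := phiM_continuous
      have a3 : Continuous PhiM := continuous_iff_continuousAt.mpr fun t => (PhiM_hasDerivAt t).continuousAt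
      fun_prop
    have heq : ∀ t : ℝ, (t * Real.log t) * phiM t - PhiM t = Real.log t * (1 - Real.exp (-t)) - PhiM t := by
      intro t; rw [← mul_phiM]; ring
    have := intervalIntegral.integral_eq_sub_of_hasDerivAt_of_le hT.le
      (f := fun t => (t * Real.log t) * phiM t - PhiM t) (f' := fun t => Real.log t * Real.exp (-t)) hc.continuousOn ?_ ?_
    · rw [this, heq]
      simp [PhiM]
      ring
    · intro t ht
      have ht0 : t ≠ 0 := ht.1.ne'
      simp_rw [heq]
      have e1 : HasDerivAt (fun t => 1 - Real.exp (-t)) (Real.exp (-t)) t := by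
        have := ((hasDerivAt_neg t).exp).const_sub 1
        simpa using this
      have e2 := ((Real.hasDerivAt_log ht0).mul e1).sub (PhiM_hasDerivAt t)
      refine HasDerivAt.congr_deriv e2 ?_
      have : t⁻¹ * (1 - Real.exp (-t)) = phiM t := by
        rw [← mul_phiM t]; field_simp
      rw [this]; ring
    · rw [intervalIntegrable_iff_integrableOn_Ioc_of_le hT.le]
      exact hIntg.mono_set Set.Ioc_subset_Ioi_self
  have h3 : Tendsto (fun T => Real.log T * Real.exp (-T)) atTop (𝓝 0) := by
    have a := Real.tendsto_pow_mul_exp_neg_atTop_nhds_zero 1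
    refine squeeze_zero' ?_ ?_ a
    · filter_upwards [eventually_ge_atTop 1] with T hT
      have := Real.log_nonneg hT
      positivity
    · filter_upwards [eventually_ge_atTop 1] with T hT
      have := Real.log_le_self (by linarith : (0:ℝ) ≤ T)
      simp only [pow_one]
      gcongr
  have h4 : Tendsto (fun T => -(∫ t in (0:ℝ)..T, Real.log t * Real.exp (-t)) - Real.log T * Real.exp (-T)) atTop
     (𝓝 Real.eulerMascheroniConstant) := by
    have := (h1.neg).sub h3
    simpa using this
  refine h4.congr' ?_
  filter_upwards [eventually_gt_atTop 0] with T hT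
  rw [h2 T hT]; ring

lemma PsiM_step {a b : ℝ} (ha : 0 < a) (hab : a ≤ b) :
    Real.exp (-b) / b * (b - a) ≤ (PhiM a - Real.log a) - (PhiM b - Real.log b) := by
  have key : ∀ x ∈ Set.Icc a b, HasDerivAt (fun x => PhiM x - Real.log x + Real.exp (-b) / b * x)
      (phiM x - x⁻¹ + Real.exp (-b) / b * 1) x := by
    intro x hx
    exact ((PhiM_hasDerivAt x).sub (Real.hasDerivAt_log (by linarith [hx.1]))).add
      ((hasDerivAt_id x).const_mul _)
  have anti : AntitoneOn (fun x => PhiM x - Real.log x + Real.exp (-b) / b * x) (Set.Icc a b) := by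
    apply antitoneOn_of_deriv_nonpos (convex_Icc a b)
    · exact fun x hx => (key x hx).continuousAt.continuousWithinAt
    · exact fun x hx => (key x (interior_subset hx)).differentiableAt.differentiableWithinAt
    · intro x hx
      have hx' := interior_subset hx
      rw [(key x hx').deriv]
      have hx0 : 0 < x := by linarith [hx'.1]
      have : phiM x = (1 - Real.exp (-x)) / x := by
        rw [← mul_phiM]; field_simp
      rw [this]
      have h2 : Real.exp (-b) / b ≤ Real.exp (-x) / x := by
        gcongr
        · exact hx'.2
        · exact hx'.2
      have : (1 - Real.exp (-x)) / x - x⁻¹ = - (Real.exp (-x) / x) := by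
        field_simp; ring
      rw [this]; linarith
  have := anti (Set.left_mem_Icc.mpr hab) (Set.right_mem_Icc.mpr hab) hab
  simp only at this
  linarith

lemma PsiM_ge {a : ℝ} (ha : 0 < a) : Real.eulerMascheroniConstant ≤ PhiM a - Real.log a := by
  apply le_of_tendsto' (x := atTop) (f := fun t => PhiM (max t a) - Real.log (max t a))
  · refine PhiM_sub_log_tendsto.congr' ?_
    filter_upwards [eventually_ge_atTop a] with t ht
    rw [max_eq_left ht]
  · intro t
    have h := PsiM_step ha (le_max_right t a)
    have hm : 0 < max t a := lt_of_lt_of_le ha (le_max_right t a)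
    have : 0 ≤ Real.exp (-(max t a)) / (max t a) * (max t a - a) := by
      have := le_max_right t a
      apply mul_nonneg (by positivity) (by linarith)
    linarith

lemma PhiM_step {a b : ℝ} (hab : a ≤ b) : PhiM b - PhiM a ≤ phiM a * (b - a) := by
  have : PhiM b - PhiM a = ∫ x in a..b, phiM x := by
    unfold PhiM
    rw [intervalIntegral.integral_interval_sub_left] <;> exact phiM_continuous.intervalIntegrable _ _
  rw [this]
  calc _ ≤ ∫ x in a..b, phiM a := intervalIntegral.integral_mono_on hab (phiM_continuous.intervalIntegrable _ _)
        (by simp) (fun x hx => phiM_antitone hx.1)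
    _ = _ := by simp; ring

lemma PhiM_mono : Monotone PhiM := by
  apply monotone_of_deriv_nonneg (fun t => (PhiM_hasDerivAt t).differentiableAt)
  intro t; rw [(PhiM_hasDerivAt t).deriv]; exact phiM_nonneg t

lemma PhiM_le {a : ℝ} (ha : 0 ≤ a) : PhiM a ≤ a := by
  have := PhiM_step ha
  have h2 := phiM_le_one (le_refl 0)
  have h3 : PhiM 0 = 0 := by simp [PhiM]
  nlinarith

lemma abel_bound {E : Type*} [NormedAddCommGroup E] [NormedSpace ℝ E] (r : ℕ → E) (w : ℕ → ℝ)
    (a b : ℕ) (hw : ∀ n, a ≤ n → w (n+1) ≤ w n) (hw0 : ∀ n, a ≤ n → 0 ≤ w n) (B : ℝ)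
    (hB : ∀ m, ‖∑ n ∈ Finset.Ico a m, r n‖ ≤ B) :
    ‖∑ n ∈ Finset.Ico a b, w n • r n‖ ≤ B * w a := by
  have hB0 : 0 ≤ B := (norm_nonneg _).trans (hB 0)
  by_cases hab : a ≤ b
  swap
  · rw [Finset.Ico_eq_empty (by omega)]
    simp
    exact mul_nonneg hB0 (hw0 a le_rfl)
  have key : ∀ b, a ≤ b → ‖∑ n ∈ Finset.Ico a b, w n • r n - w b • ∑ n ∈ Finset.Ico a b, r n‖
      ≤ B * (w a - w b) := by
    intro b hb
    induction b, hb using Nat.le_induction with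
    | base => simp
    | succ b hb ih =>
      rw [Finset.sum_Ico_succ_top hb]
      have e : ∑ n ∈ Finset.Ico a b, w n • r n + w b • r b - w (b+1) • ∑ n ∈ Finset.Ico a (b+1), r n
        = (∑ n ∈ Finset.Ico a b, w n • r n - w b • ∑ n ∈ Finset.Ico a b, r n)
          + (w b - w (b+1)) • ∑ n ∈ Finset.Ico a (b+1), r n := by
        rw [Finset.sum_Ico_succ_top hb, sub_smul, smul_add, smul_add]
        abel
      rw [e]
      refine (norm_add_le _ _).trans ?_
      rw [norm_smul, Real.norm_of_nonneg (by linarith [hw b hb])]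
      have := mul_le_mul_of_nonneg_left (hB (b+1)) (by linarith [hw b hb] : 0 ≤ w b - w (b+1))
      nlinarith
  have h1 := key b hab
  have h2 : ‖w b • ∑ n ∈ Finset.Ico a b, r n‖ ≤ B * w b := by
    rw [norm_smul, Real.norm_of_nonneg (hw0 b hab), mul_comm]
    exact mul_le_mul_of_nonneg_right (hB b) (hw0 b hab)
  have h3 := norm_add_le (∑ n ∈ Finset.Ico a b, w n • r n - w b • ∑ n ∈ Finset.Ico a b, r n)
    (w b • ∑ n ∈ Finset.Ico a b, r n)
  rw [sub_add_cancel] at h3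
  linarith

lemma log_factorial_eq (N : ℕ) : Real.log (N.factorial) =
    ∑ p ∈ Nat.primesBelow (N+1), (padicValNat p N.factorial : ℝ) * Real.log p := by
  rw [Real.log_nat_eq_sum_factorization, Finsupp.sum]
  have h : ∑ p ∈ Nat.primesBelow (N+1), (padicValNat p N.factorial : ℝ) * Real.log p
    = ∑ p ∈ Nat.primesBelow (N+1), (N.factorial.factorization p : ℝ) * Real.log p := by
    apply Finset.sum_congr rfl
    intro p hp
    rw [Nat.factorization_def _ (Nat.prime_of_mem_primesBelow hp)]
  rw [h]
  apply Finset.sum_subset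
  · intro p hp
    rw [Nat.support_factorization] at hp
    have hpp := Nat.prime_of_mem_primeFactors hp
    have := (hpp.dvd_factorial).mp (Nat.dvd_of_mem_primeFactors hp)
    rw [Nat.mem_primesBelow]
    exact ⟨by omega, hpp⟩
  · intro p _ hp
    rw [Finsupp.notMem_support_iff] at hp
    simp [hp]

lemma mertens_one : ∃ C : ℝ, 0 ≤ C ∧ ∀ N : ℕ, 1 ≤ N →
    |∑ p ∈ Nat.primesBelow (N+1), Real.log p / p - Real.log N| ≤ C := by
  have hsum : Summable (fun n : ℕ => 4 * (n:ℝ) ^ (-(3/2) : ℝ)) :=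
    (Real.summable_nat_rpow.mpr (by norm_num)).mul_left 4
  set Z := ∑' n : ℕ, 4 * (n:ℝ) ^ (-(3/2) : ℝ)
  have hZ : 0 ≤ Z := tsum_nonneg (fun n => by positivity)
  have hl4 : 0 ≤ Real.log 4 := Real.log_nonneg (by norm_num)
  refine ⟨1 + Z + Real.log 4, by positivity, ?_⟩
  intro N hN
  have hN0 : (0:ℝ) < N := by exact_mod_cast hN
  have hup : Real.log N.factorial ≤ N * Real.log N := by
    rw [← Real.log_pow]
    apply Real.log_le_log (by exact_mod_cast Nat.factorial_pos N)
    exact_mod_cast Nat.factorial_le_pow N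
  have hlo : N * Real.log N - N ≤ Real.log N.factorial := by
    have := Stirling.le_log_factorial_stirling (n := N) (by omega)
    have h1 : 0 ≤ Real.log N := Real.log_nonneg (by exact_mod_cast hN)
    have h2 : 0 ≤ Real.log (2 * Real.pi) := Real.log_nonneg (by nlinarith [Real.pi_gt_three])
    linarith
  rw [log_factorial_eq] at hup hlo
  have hth : ∑ p ∈ Nat.primesBelow (N+1), Real.log p ≤ Real.log 4 * N := by
    have := Chebyshev.theta_le_log4_mul_x (x := N) hN0.le
    rw [Chebyshev.theta_eq_sum_primesLE_log] at this
    exact this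
  have hpp : ∀ p ∈ Nat.primesBelow (N+1), p.Prime := fun p hp => Nat.prime_of_mem_primesBelow hp
  have b1 : ∑ p ∈ Nat.primesBelow (N+1), (N * (Real.log p / p) - Real.log p) ≤
      ∑ p ∈ Nat.primesBelow (N+1), (padicValNat p N.factorial : ℝ) * Real.log p := by
    apply Finset.sum_le_sum
    intro p hp
    have hp' := hpp p hp
    haveI : Fact p.Prime := ⟨hp'⟩
    have hp0 : (0:ℝ) < p := by exact_mod_cast hp'.pos
    have hv : N / p ≤ padicValNat p N.factorial := by
      rw [padicValNat_factorial (b := Nat.log p N + 2) (by omega)]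
      have : (1:ℕ) ∈ Finset.Ico 1 (Nat.log p N + 2) := by simp
      have h := Finset.single_le_sum (f := fun i => N / p ^ i) (fun i _ => Nat.zero_le _) this
      simpa using h
    have hv2 : (N:ℝ) / p - 1 ≤ padicValNat p N.factorial := by
      have a : (N:ℝ) / p < (N / p : ℕ) + 1 := by
        have := Nat.lt_floor_add_one ((N:ℝ)/p)
        rwa [Nat.floor_div_natCast, Nat.floor_natCast] at this
      have b : ((N / p : ℕ):ℝ) ≤ padicValNat p N.factorial := by exact_mod_cast hv
      linarith
    have hlog : 0 ≤ Real.log p := Real.log_nonneg (by exact_mod_cast hp'.one_lt.le)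
    calc _ = ((N:ℝ) / p - 1) * Real.log p := by field_simp
      _ ≤ _ := by gcongr
  have b2 : ∑ p ∈ Nat.primesBelow (N+1), (padicValNat p N.factorial : ℝ) * Real.log p ≤
     ∑ p ∈ Nat.primesBelow (N+1), (N * (Real.log p / p) + N * (4 * (p:ℝ) ^ (-(3/2) : ℝ))) := by
    apply Finset.sum_le_sum
    intro p hp
    have hp' := hpp p hp
    haveI : Fact p.Prime := ⟨hp'⟩
    have hp0 : (0:ℝ) < p := by exact_mod_cast hp'.pos
    have hp2 : (2:ℝ) ≤ p := by exact_mod_cast hp'.two_le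
    have hv : ((p:ℝ) - 1) * padicValNat p N.factorial ≤ N := by
      have := (sub_one_mul_padicValNat_factorial_lt_of_ne_zero p (n := N) (by omega)).le
      have h : (((p - 1 : ℕ) * padicValNat p N.factorial : ℕ) : ℝ) ≤ N := by exact_mod_cast this
      rw [Nat.cast_mul, Nat.cast_sub hp'.one_lt.le] at h
      simpa using h
    have hlog : 0 ≤ Real.log p := Real.log_nonneg (by linarith)
    have hv' : (padicValNat p N.factorial : ℝ) ≤ N / p + N * (2 / p^2) := by
      have h1 : (padicValNat p N.factorial : ℝ) ≤ N / (p - 1) := by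
        rw [le_div_iff₀ (by linarith)]; linarith
      have h2 : (1:ℝ) / (p-1) ≤ 1 / p + 2 / p^2 := by
        rw [div_add_div _ _ (by positivity) (by positivity), div_le_div_iff₀ (by linarith) (by positivity)]
        nlinarith
      calc _ ≤ N * ((1:ℝ) / (p-1)) := by rw [mul_one_div]; exact h1
        _ ≤ N * (1 / p + 2 / p^2) := by gcongr
        _ = _ := by ring
    have hl : Real.log p ≤ 2 * (p:ℝ) ^ (1/2 : ℝ) := by
      have := Real.log_le_rpow_div hp0.le (ε := 1/2) (by norm_num)
      linarith
    calc _ ≤ (N / p + N * (2 / p^2)) * Real.log p := by gcongr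
      _ = N * (Real.log p / p) + N * (2 / p^2 * Real.log p) := by ring
      _ ≤ N * (Real.log p / p) + N * (2 / p^2 * (2 * (p:ℝ) ^ (1/2 : ℝ))) := by gcongr
      _ = _ := by
        congr 2
        have : (p:ℝ) ^ (-(3/2) : ℝ) = (p:ℝ) ^ (1/2 : ℝ) / p^2 := by
          rw [← Real.rpow_natCast, ← Real.rpow_sub hp0]; norm_num
        rw [this]; ring
  rw [Finset.sum_sub_distrib, ← Finset.mul_sum] at b1
  rw [Finset.sum_add_distrib, ← Finset.mul_sum, ← Finset.mul_sum] at b2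
  have b3 : ∑ p ∈ Nat.primesBelow (N+1), 4 * (p:ℝ) ^ (-(3/2) : ℝ) ≤ Z :=
    hsum.sum_le_tsum _ (fun n _ => by positivity)
  have b4 := mul_le_mul_of_nonneg_left b3 hN0.le
  set S := ∑ p ∈ Nat.primesBelow (N+1), Real.log p / p
  have u : N * (S - Real.log N) ≤ N * (Real.log 4) := by linarith
  have l : N * (-(1 + Z)) ≤ N * (S - Real.log N) := by linarith
  have u' := le_of_mul_le_mul_left u hN0
  have l' := le_of_mul_le_mul_left l hN0
  rw [abs_le]
  constructor <;> linarith

noncomputable def lpM (n : ℕ) : ℝ := if n.Prime then Real.log n / n else 0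

lemma sum_lpM_mul (f : ℕ → ℝ) (a b : ℕ) :
    ∑ n ∈ Finset.Ico a b, f n * lpM n = ∑ p ∈ (Finset.Ico a b).filter Nat.Prime, f p * (Real.log p / p) := by
  rw [Finset.sum_filter]
  apply Finset.sum_congr rfl
  intro n _
  unfold lpM
  split_ifs <;> simp

lemma primesBelow_split {a b : ℕ} (hab : a ≤ b) (f : ℕ → ℝ) :
    ∑ p ∈ Nat.primesBelow b, f p = ∑ p ∈ Nat.primesBelow a, f p +
      ∑ p ∈ (Finset.Ico a b).filter Nat.Prime, f p := by
  rw [Nat.primesBelow_eq_filter_range, Nat.primesBelow_eq_filter_range, Finset.sum_filter, Finset.sum_filter,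
    Finset.sum_filter, Finset.sum_range_add_sum_Ico _ hab]

lemma primesBelow_two_filter (b : ℕ) : (Finset.Ico 2 b).filter Nat.Prime = Nat.primesBelow b := by
  ext p
  simp only [Finset.mem_filter, Finset.mem_Ico, Nat.mem_primesBelow]
  constructor
  · rintro ⟨⟨_, h⟩, h2⟩; exact ⟨h, h2⟩
  · rintro ⟨h, h2⟩; exact ⟨⟨h2.two_le, h⟩, h2⟩

lemma sum_lpM {a b : ℕ} (hab : a ≤ b) :
    ∑ n ∈ Finset.Ico a b, lpM n = ∑ p ∈ Nat.primesBelow b, Real.log p / p -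
      ∑ p ∈ Nat.primesBelow a, Real.log p / p := by
  have := sum_lpM_mul (fun _ => 1) a b
  simp only [one_mul] at this
  rw [this, primesBelow_split hab]; ring

lemma step_one : ∃ C : ℝ, ∀ Y : ℕ, 3 ≤ Y → ∀ s : ℝ, s = 1 / Real.log Y →
    PhiM 1 - C * s ≤ ∑ p ∈ Nat.primesBelow (Y+1), (1 / (p:ℝ) - (p:ℝ) ^ (-(1 + s))) := by
  obtain ⟨C, hC0, hC⟩ := mertens_one
  refine ⟨C + 3 * Real.log 2, ?_⟩
  intro Y hY s hs
  have hYr : (3:ℝ) ≤ Y := by exact_mod_cast hY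
  have hlogY : 0 < Real.log Y := Real.log_pos (by linarith)
  have hs0 : 0 < s := by rw [hs]; positivity
  set w : ℕ → ℝ := fun n => s * phiM (s * Real.log n) with hw
  have hl2 : 0 ≤ Real.log 2 := Real.log_nonneg (by norm_num)
  have e1 : ∑ p ∈ Nat.primesBelow (Y+1), (1 / (p:ℝ) - (p:ℝ) ^ (-(1 + s))) =
      ∑ n ∈ Finset.Ico 2 (Y+1), w n * lpM n := by
    rw [sum_lpM_mul, primesBelow_two_filter]
    apply Finset.sum_congr rfl
    intro p hp
    have hp' := Nat.prime_of_mem_primesBelow hp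
    have hp0 : (0:ℝ) < p := by exact_mod_cast hp'.pos
    have h := mul_phiM (s * Real.log p)
    have h2 : (p:ℝ) ^ (-(1 + s)) = 1 / p * Real.exp (-(s * Real.log p)) := by
      rw [neg_add, Real.rpow_add hp0, Real.rpow_neg_one, Real.rpow_def_of_pos hp0]
      simp; left; ring
    rw [h2, hw]
    simp only
    calc _ = 1 / (p:ℝ) * (1 - Real.exp (-(s * Real.log p))) := by ring
      _ = _ := by rw [← h]; ring
  set r : ℕ → ℝ := fun n => lpM n - (Real.log (n+1) - Real.log n) with hr
  have tele : ∀ m : ℕ, 2 ≤ m → ∑ n ∈ Finset.Ico 2 m, (Real.log ((n:ℝ)+1) - Real.log n) = Real.log m - Real.log 2 := by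
    intro m hm
    have := Finset.sum_Ico_sub (fun n : ℕ => Real.log n) hm
    push_cast at this
    exact this
  have hB : ∀ m, ‖∑ n ∈ Finset.Ico 2 m, r n‖ ≤ C + 2 * Real.log 2 := by
    intro m
    by_cases hm : 2 ≤ m
    · rw [hr, Finset.sum_sub_distrib, tele m hm, sum_lpM hm]
      have h0 : Nat.primesBelow 2 = ∅ := Nat.primesBelow_two
      rw [h0, Finset.sum_empty, Real.norm_eq_abs]
      obtain ⟨k, rfl⟩ : ∃ k, m = k + 1 := ⟨m - 1, by omega⟩
      have h1 := abs_le.mp (hC k (by omega))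
      have hk : (1:ℝ) ≤ k := by exact_mod_cast (by omega : 1 ≤ k)
      have h2 : Real.log ((k+1 : ℕ):ℝ) ≤ Real.log k + Real.log 2 := by
        rw [← Real.log_mul (by linarith) (by norm_num)]
        apply Real.log_le_log <;> push_cast <;> linarith
      have h3 : Real.log k ≤ Real.log ((k+1 : ℕ):ℝ) := by
        apply Real.log_le_log <;> push_cast <;> linarith
      rw [abs_le]
      constructor <;> linarith [h1.1, h1.2]
    · rw [Finset.Ico_eq_empty (by omega)]; simp; positivity
  have hmono : ∀ n : ℕ, 2 ≤ n → w (n+1) ≤ w n := by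
    intro n hn
    simp only [hw]
    have : (0:ℝ) < n := by exact_mod_cast (by omega : 0 < n)
    apply mul_le_mul_of_nonneg_left _ hs0.le
    apply phiM_antitone
    apply mul_le_mul_of_nonneg_left _ hs0.le
    apply Real.log_le_log this; push_cast; linarith
  have ab := abel_bound r w 2 (Y+1) hmono (fun n _ => mul_nonneg hs0.le (phiM_nonneg _)) _ hB
  have hw2 : w 2 ≤ s := by
    simp only [hw]
    have := phiM_le_one (x := s * Real.log (2:ℕ)) (by push_cast; positivity)
    nlinarith
  have ab' : -((C + 2 * Real.log 2) * s) ≤ ∑ n ∈ Finset.Ico 2 (Y+1), w n * r n := by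
    rw [Real.norm_eq_abs] at ab
    have := (abs_le.mp ab).1
    simp only [smul_eq_mul] at this
    have h : (C + 2 * Real.log 2) * w 2 ≤ (C + 2 * Real.log 2) * s := by gcongr
    linarith
  have main : PhiM 1 - s * Real.log 2 ≤ ∑ n ∈ Finset.Ico 2 (Y+1), w n * (Real.log ((n:ℝ)+1) - Real.log n) := by
    have t := Finset.sum_Ico_sub (fun n : ℕ => PhiM (s * Real.log n)) (by omega : 2 ≤ Y + 1)
    have h1 : ∑ n ∈ Finset.Ico 2 (Y+1), (PhiM (s * Real.log (n+1 : ℕ)) - PhiM (s * Real.log n)) ≤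
      ∑ n ∈ Finset.Ico 2 (Y+1), w n * (Real.log ((n:ℝ)+1) - Real.log n) := by
      apply Finset.sum_le_sum
      intro n hn
      have hn2 := (Finset.mem_Ico.mp hn).1
      have : (0:ℝ) < n := by exact_mod_cast (by omega : 0 < n)
      have hle : s * Real.log n ≤ s * Real.log (n+1:ℕ) := by
        apply mul_le_mul_of_nonneg_left _ hs0.le
        apply Real.log_le_log this; push_cast; linarith
      refine (PhiM_step hle).trans (le_of_eq ?_)
      simp only [hw]; push_cast; ring
    rw [t] at h1
    have h2 : PhiM (s * Real.log (2:ℕ)) ≤ s * Real.log 2 := by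
      have := PhiM_le (a := s * Real.log (2:ℕ)) (by push_cast; positivity)
      exact_mod_cast this
    have h3 : PhiM 1 ≤ PhiM (s * Real.log (Y+1 : ℕ)) := by
      apply PhiM_mono
      have : Real.log Y ≤ Real.log (Y+1:ℕ) := by
        apply Real.log_le_log <;> push_cast <;> linarith
      rw [hs, one_div, ← div_eq_inv_mul, le_div_iff₀ hlogY]; linarith
    linarith
  have e2 : ∑ n ∈ Finset.Ico 2 (Y+1), w n * lpM n = ∑ n ∈ Finset.Ico 2 (Y+1), w n * r n +
      ∑ n ∈ Finset.Ico 2 (Y+1), w n * (Real.log ((n:ℝ)+1) - Real.log n) := by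
    rw [← Finset.sum_add_distrib]
    apply Finset.sum_congr rfl
    intro n _
    simp only [hr]; ring
  rw [e1, e2]
  linarith

lemma step_two : ∃ C : ℝ, ∀ Y : ℕ, 3 ≤ Y → ∀ s : ℝ, s = 1 / Real.log Y → ∀ M : ℕ, Y + 1 ≤ M →
    ∑ p ∈ (Finset.Ico (Y+1) M).filter Nat.Prime, (p:ℝ) ^ (-(1 + s)) ≤
      PhiM 1 - Real.eulerMascheroniConstant + C * s := by
  obtain ⟨C, hC0, hC⟩ := mertens_one
  refine ⟨2 * C, ?_⟩
  intro Y hY s hs M hM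
  have hYr : (3:ℝ) ≤ Y := by exact_mod_cast hY
  have hlogY : 0 < Real.log Y := Real.log_pos (by linarith)
  have hs0 : 0 < s := by rw [hs]; positivity
  set w : ℕ → ℝ := fun n => Real.exp (-(s * Real.log n)) / Real.log n with hw
  have e1 : ∑ p ∈ (Finset.Ico (Y+1) M).filter Nat.Prime, (p:ℝ) ^ (-(1 + s)) =
      ∑ n ∈ Finset.Ico (Y+1) M, w n * lpM n := by
    rw [sum_lpM_mul]
    apply Finset.sum_congr rfl
    intro p hp
    have hp' := (Finset.mem_filter.mp hp).2
    have hp0 : (0:ℝ) < p := by exact_mod_cast hp'.pos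
    have hl : 0 < Real.log p := Real.log_pos (by exact_mod_cast hp'.one_lt)
    have h2 : (p:ℝ) ^ (-(1 + s)) = 1 / p * Real.exp (-(s * Real.log p)) := by
      rw [neg_add, Real.rpow_add hp0, Real.rpow_neg_one, Real.rpow_def_of_pos hp0]
      simp; left; ring
    rw [h2, hw]
    simp only
    field_simp
  set r : ℕ → ℝ := fun n => lpM n - (Real.log n - Real.log ((n:ℝ)-1)) with hr
  have tele : ∀ m : ℕ, Y + 1 ≤ m → ∀ F : ℝ → ℝ, ∑ n ∈ Finset.Ico (Y+1) m, (F n - F ((n:ℝ)-1)) = F ((m:ℝ)-1) - F Y := by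
    intro m hm F
    have := Finset.sum_Ico_sub (fun n : ℕ => F ((n:ℝ)-1)) hm
    push_cast at this
    simpa using this
  have hB : ∀ m, ‖∑ n ∈ Finset.Ico (Y+1) m, r n‖ ≤ 2 * C := by
    intro m
    by_cases hm : Y + 1 ≤ m
    · rw [hr, Finset.sum_sub_distrib, tele m hm Real.log, sum_lpM hm]
      obtain ⟨k, rfl⟩ : ∃ k, m = k + 1 := ⟨m - 1, by omega⟩
      have h1 := abs_le.mp (hC k (by omega))
      have h2 := abs_le.mp (hC Y (by omega))
      rw [Real.norm_eq_abs, abs_le]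
      push_cast
      rw [add_sub_cancel_right]
      constructor <;> linarith [h1.1, h1.2, h2.1, h2.2]
    · rw [Finset.Ico_eq_empty (by omega)]; simp; positivity
  have hmono : ∀ a b : ℕ, Y ≤ a → a ≤ b → w b ≤ w a := by
    intro a b ha hab
    have ha3 : (3:ℝ) ≤ a := by exact_mod_cast hY.trans ha
    have hl : 0 < Real.log a := Real.log_pos (by linarith)
    have hab' : Real.log a ≤ Real.log b := by
      apply Real.log_le_log (by linarith); exact_mod_cast hab
    simp only [hw]
    gcongr
  have hw0 : ∀ a : ℕ, Y ≤ a → 0 ≤ w a := by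
    intro a ha
    have ha3 : (3:ℝ) ≤ a := by exact_mod_cast hY.trans ha
    have hl : 0 < Real.log a := Real.log_pos (by linarith)
    simp only [hw]; positivity
  have ab := abel_bound r w (Y+1) M (fun n hn => hmono _ _ (by omega) (by omega)) (fun n hn => hw0 n (by omega)) _ hB
  have hwY : w (Y+1) ≤ s := by
    refine (hmono Y (Y+1) le_rfl (by omega)).trans ?_
    simp only [hw]
    rw [hs]
    have : Real.exp (-(1 / Real.log Y * Real.log Y)) ≤ 1 := Real.exp_le_one_iff.mpr (by
      rw [one_div, inv_mul_cancel₀ hlogY.ne']; norm_num)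
    gcongr
  have ab' : ∑ n ∈ Finset.Ico (Y+1) M, w n * r n ≤ 2 * C * s := by
    rw [Real.norm_eq_abs] at ab
    have := (abs_le.mp ab).2
    simp only [smul_eq_mul] at this
    have h : 2 * C * w (Y+1) ≤ 2 * C * s := by gcongr
    linarith
  have main : ∑ n ∈ Finset.Ico (Y+1) M, w n * (Real.log n - Real.log ((n:ℝ)-1)) ≤
      PhiM 1 - Real.eulerMascheroniConstant := by
    set F : ℝ → ℝ := fun x => -(PhiM (s * Real.log x) - Real.log (s * Real.log x)) with hF
    have t := tele M hM F
    have h1 : ∑ n ∈ Finset.Ico (Y+1) M, w n * (Real.log n - Real.log ((n:ℝ)-1)) ≤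
      ∑ n ∈ Finset.Ico (Y+1) M, (F n - F ((n:ℝ)-1)) := by
      apply Finset.sum_le_sum
      intro n hn
      have hn2 := (Finset.mem_Ico.mp hn).1
      have hn4 : (4:ℝ) ≤ n := by exact_mod_cast (by omega : 4 ≤ n)
      have hl : 0 < Real.log ((n:ℝ)-1) := Real.log_pos (by linarith)
      have hle' : Real.log ((n:ℝ)-1) ≤ Real.log n := Real.log_le_log (by linarith) (by linarith)
      have hle : s * Real.log ((n:ℝ)-1) ≤ s * Real.log n := by gcongr
      have hl' : 0 < Real.log n := by linarith
      have := PsiM_step (mul_pos hs0 hl) hle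
      simp only [hF]
      have e : w n * (Real.log n - Real.log ((n:ℝ)-1)) = Real.exp (-(s * Real.log n)) / (s * Real.log n) * (s * Real.log n - s * Real.log ((n:ℝ)-1)) := by
        simp only [hw]; field_simp
      linarith
    rw [t] at h1
    have hM3 : (3:ℝ) ≤ (M:ℝ) - 1 := by
      have : (4:ℝ) ≤ M := by exact_mod_cast (by omega : 4 ≤ M)
      linarith
    have h2 := PsiM_ge (a := s * Real.log ((M:ℝ)-1)) (mul_pos hs0 (Real.log_pos (by linarith)))
    have h3 : s * Real.log Y = 1 := by rw [hs]; field_simp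
    simp only [hF, h3, Real.log_one] at h1
    linarith
  have e2 : ∑ n ∈ Finset.Ico (Y+1) M, w n * lpM n = ∑ n ∈ Finset.Ico (Y+1) M, w n * r n +
      ∑ n ∈ Finset.Ico (Y+1) M, w n * (Real.log n - Real.log ((n:ℝ)-1)) := by
    rw [← Finset.sum_add_distrib]
    apply Finset.sum_congr rfl
    intro n _
    simp only [hr]; ring
  rw [e1, e2]
  linarith

lemma neglog_mono {x y : ℝ} (h0 : 0 ≤ y) (hyx : y ≤ x) (hx : x < 1) :
    -Real.log (1 - y) ≤ -Real.log (1 - x) - (x - y) := by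
  have h1 : 0 < 1 - x := by linarith
  have h2 : 0 < 1 - y := by linarith
  have h3 := Real.log_le_sub_one_of_pos (div_pos h1 h2)
  rw [Real.log_div h1.ne' h2.ne'] at h3
  have h4 : (1 - x) / (1 - y) - 1 ≤ y - x := by
    rw [sub_le_iff_le_add, div_le_iff₀ h2]
    nlinarith
  linarith

lemma neglog_le {z : ℝ} (h0 : 0 ≤ z) (hz : z ≤ 1 / 2) : -Real.log (1 - z) ≤ z + 2 * z ^ 2 := by
  have h1 : 0 < 1 - z := by linarith
  have h3 := Real.log_le_sub_one_of_pos (inv_pos.2 h1)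
  rw [Real.log_inv] at h3
  have h4 : (1 - z)⁻¹ - 1 ≤ z + 2 * z ^ 2 := by
    rw [sub_le_iff_le_add, inv_le_iff_one_le_mul₀ h1]
    nlinarith [mul_nonneg (sq_nonneg z) (by linarith : (0:ℝ) ≤ 1 - 2 * z)]
  linarith

lemma rpow_neg_le_inv {p : ℕ} (hp : 1 ≤ p) {s : ℝ} (hs : 0 ≤ s) :
    (p : ℝ) ^ (-(1 + s)) ≤ 1 / (p : ℝ) := by
  have h : (1:ℝ) ≤ p := by exact_mod_cast hp
  calc (p : ℝ) ^ (-(1 + s)) ≤ (p : ℝ) ^ (-1 : ℝ) :=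
        Real.rpow_le_rpow_of_exponent_le h (by linarith)
    _ = 1 / (p : ℝ) := by rw [Real.rpow_neg_one, one_div]

lemma inv_prime_lt_one {p : ℕ} (hp : p.Prime) : 1 / (p : ℝ) ≤ 1 / 2 := by
  have : (2:ℝ) ≤ p := by exact_mod_cast hp.two_le
  exact one_div_le_one_div_of_le (by norm_num) this

lemma mertens_fin : ∃ C : ℝ, ∀ Y : ℕ, 3 ≤ Y → ∀ s : ℝ, s = 1 / Real.log Y → ∀ M : ℕ, Y + 1 ≤ M →
    ∑ p ∈ Nat.primesBelow M, -Real.log (1 - (p : ℝ) ^ (-(1 + s))) ≤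
      ∑ p ∈ Nat.primesBelow (Y + 1), -Real.log (1 - 1 / (p : ℝ)) -
        Real.eulerMascheroniConstant + C * s := by
  obtain ⟨C1, h1⟩ := step_one
  obtain ⟨C2, h2⟩ := step_two
  refine ⟨C1 + C2 + 4, ?_⟩
  intro Y hY s hs M hM
  have hY3 : (3:ℝ) ≤ Y := by exact_mod_cast hY
  have hlog : 0 < Real.log Y := Real.log_pos (by linarith)
  have hs0 : 0 < s := by rw [hs]; positivity
  have a1 := h1 Y hY s hs
  have a2 := h2 Y hY s hs M hM
  rw [primesBelow_split hM]
  have b1 : ∑ p ∈ Nat.primesBelow (Y + 1), -Real.log (1 - (p : ℝ) ^ (-(1 + s))) ≤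
      ∑ p ∈ Nat.primesBelow (Y + 1), -Real.log (1 - 1 / (p : ℝ)) -
      ∑ p ∈ Nat.primesBelow (Y + 1), (1/(p:ℝ) - (p:ℝ)^(-(1+s))) := by
    rw [← Finset.sum_sub_distrib]
    apply Finset.sum_le_sum
    intro p hp
    have hpp := Nat.prime_of_mem_primesBelow hp
    have := inv_prime_lt_one hpp
    exact neglog_mono (by positivity) (rpow_neg_le_inv hpp.one_le hs0.le) (by linarith)
  have b2 : ∑ p ∈ (Finset.Ico (Y+1) M).filter Nat.Prime, -Real.log (1 - (p : ℝ) ^ (-(1 + s))) ≤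
      ∑ p ∈ (Finset.Ico (Y+1) M).filter Nat.Prime, (p : ℝ) ^ (-(1 + s)) +
      ∑ p ∈ (Finset.Ico (Y+1) M).filter Nat.Prime, 2 * ((p : ℝ)^2)⁻¹ := by
    rw [← Finset.sum_add_distrib]
    apply Finset.sum_le_sum
    intro p hp
    have hpp := (Finset.mem_filter.1 hp).2
    have e1 := inv_prime_lt_one hpp
    have e2 := rpow_neg_le_inv hpp.one_le hs0.le
    have e0 : 0 ≤ (p : ℝ) ^ (-(1 + s)) := by positivity
    refine (neglog_le e0 (by linarith)).trans ?_
    have : ((p : ℝ) ^ (-(1 + s)))^2 ≤ ((p : ℝ)^2)⁻¹ := by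
      calc _ ≤ (1 / (p:ℝ))^2 := pow_le_pow_left₀ e0 e2 2
        _ = _ := by rw [one_div, inv_pow]
    linarith
  have b3 : ∑ p ∈ (Finset.Ico (Y+1) M).filter Nat.Prime, 2 * ((p : ℝ)^2)⁻¹ ≤ 4 * s := by
    calc _ ≤ ∑ p ∈ Finset.Ico (Y+1) M, 2 * ((p : ℝ)^2)⁻¹ := by
          apply Finset.sum_le_sum_of_subset_of_nonneg (Finset.filter_subset _ _)
          intros; positivity
      _ = 2 * ∑ p ∈ Finset.Ioo Y M, ((p : ℝ)^2)⁻¹ := by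
          rw [Finset.mul_sum]; rfl
      _ ≤ 2 * (2 / (Y + 1)) := by
          gcongr; exact sum_Ioo_inv_sq_le Y M
      _ ≤ 4 * s := by
          rw [hs]
          have : Real.log Y ≤ Y + 1 := by
            have := Real.log_le_sub_one_of_pos (by linarith : (0:ℝ) < Y)
            linarith
          have := one_div_le_one_div_of_le hlog this
          calc 2 * (2 / ((Y:ℝ) + 1)) = 4 * (1 / ((Y:ℝ) + 1)) := by ring
            _ ≤ _ := by linarith
  linarith

lemma zeta_le_of_fin (s L : ℝ) (hs : 0 < s) (M0 : ℕ)
    (h : ∀ M : ℕ, M0 ≤ M → ∑ p ∈ Nat.primesBelow M, -Real.log (1 - (p : ℝ) ^ (-(1 + s))) ≤ L) :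
    Real.log (riemannZeta ((1 + s : ℝ) : ℂ)).re ≤ L := by
  have h1 : 1 < (((1 + s : ℝ) : ℂ)).re := by rw [Complex.ofReal_re]; linarith
  have ht := riemannZeta_eulerProduct h1
  have hpos : 0 < (riemannZeta ((1 + s : ℝ) : ℂ)).re := riemannZeta_re_pos_of_one_lt (by linarith)
  have ht2 := (Complex.continuous_re.tendsto _).comp ht
  have hle : (riemannZeta ((1 + s : ℝ) : ℂ)).re ≤ Real.exp L := by
    refine le_of_tendsto ht2 ?_
    filter_upwards [eventually_ge_atTop M0] with M hM
    have e : ∏ p ∈ Nat.primesBelow M, (1 - (p : ℂ) ^ (-((1 + s : ℝ) : ℂ)))⁻¹ =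
       ((∏ p ∈ Nat.primesBelow M, (1 - (p : ℝ) ^ (-(1 + s)))⁻¹ : ℝ) : ℂ) := by
      rw [Complex.ofReal_prod]
      apply Finset.prod_congr rfl
      intro p hp
      rw [Complex.ofReal_inv, Complex.ofReal_sub, Complex.ofReal_cpow (Nat.cast_nonneg p)]
      simp
    simp only [Function.comp]
    rw [e, Complex.ofReal_re]
    have : ∏ p ∈ Nat.primesBelow M, (1 - (p : ℝ) ^ (-(1 + s)))⁻¹ =
        Real.exp (∑ p ∈ Nat.primesBelow M, -Real.log (1 - (p : ℝ) ^ (-(1 + s)))) := by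
      rw [Real.exp_sum]
      apply Finset.prod_congr rfl
      intro p hp
      have hpp := Nat.prime_of_mem_primesBelow hp
      have e1 := inv_prime_lt_one hpp
      have e2 := rpow_neg_le_inv hpp.one_le hs.le
      rw [Real.exp_neg, Real.exp_log (by linarith)]
    rw [this]
    exact Real.exp_le_exp.2 (h M hM)
  rw [← Real.log_exp L]
  exact Real.log_le_log hpos hle

lemma mertens_lower : ∃ C : ℝ, ∀ᶠ Y : ℕ in atTop,
    Real.exp Real.eulerMascheroniConstant * Real.log Y - C ≤
      ∏ p ∈ Nat.primesBelow (Y + 1), (1 - (p : ℝ)⁻¹)⁻¹ := by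
  obtain ⟨C1, h1⟩ := mertens_fin
  obtain ⟨C2, h2⟩ := log_riemannZeta_add_log_sub_isBigO_ofReal.bound
  refine ⟨Real.exp Real.eulerMascheroniConstant * (C1 + C2), ?_⟩
  have hlogt : Tendsto (fun Y : ℕ => Real.log (Y : ℝ)) atTop atTop :=
    Real.tendsto_log_atTop.comp tendsto_natCast_atTop_atTop
  have ht : Tendsto (fun Y : ℕ => 1 + 1 / Real.log (Y : ℝ)) atTop (𝓝[>] 1) := by
    apply tendsto_nhdsWithin_of_tendsto_nhds_of_eventually_within
    · have := (tendsto_const_nhds (x := (1:ℝ)) (f := (atTop : Filter ℕ))).add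
        (tendsto_inv_atTop_zero.comp hlogt)
      simpa using this
    · filter_upwards [hlogt.eventually_gt_atTop 0] with Y hY
      simp only [Set.mem_Ioi]
      have : 0 < 1 / Real.log (Y:ℝ) := by positivity
      linarith
  filter_upwards [ht.eventually h2, eventually_ge_atTop 3] with Y hz hY
  have hY3 : (3:ℝ) ≤ Y := by exact_mod_cast hY
  have hlog : 0 < Real.log Y := Real.log_pos (by linarith)
  set s := 1 / Real.log Y with hs
  have hs0 : 0 < s := by positivity
  have a := zeta_le_of_fin s _ hs0 (Y + 1) (fun M hM => h1 Y hY s hs M hM)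
  rw [Real.norm_eq_abs, Real.norm_eq_abs] at hz
  have e1 : (1 + s - 1) = s := by ring
  rw [e1, abs_of_pos hs0] at hz
  have hz' := (abs_le.1 hz).1
  have e2 : Real.log s = - Real.log (Real.log Y) := by
    rw [hs, one_div, Real.log_inv]
  rw [e2] at hz'
  set S := ∑ p ∈ Nat.primesBelow (Y + 1), -Real.log (1 - 1 / (p : ℝ)) with hS
  have hfin : Real.log (Real.log Y) + Real.eulerMascheroniConstant - (C1 + C2) * s ≤ S := by
    linarith
  have : ∏ p ∈ Nat.primesBelow (Y + 1), (1 - (p : ℝ)⁻¹)⁻¹ = Real.exp S := by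
    rw [hS, Real.exp_sum]
    apply Finset.prod_congr rfl
    intro p hp
    have hpp := Nat.prime_of_mem_primesBelow hp
    have e1 := inv_prime_lt_one hpp
    rw [Real.exp_neg, Real.exp_log (by linarith), one_div]
  rw [this]
  refine le_trans ?_ (Real.exp_le_exp.2 hfin)
  have : Real.exp (Real.log (Real.log Y) + Real.eulerMascheroniConstant - (C1 + C2) * s) =
     Real.log Y * Real.exp Real.eulerMascheroniConstant * Real.exp (-((C1 + C2) * s)) := by
    rw [sub_eq_add_neg, Real.exp_add, Real.exp_add, Real.exp_log hlog]
  rw [this]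
  have h5 := Real.add_one_le_exp (-((C1 + C2) * s))
  have h6 : Real.log Y * s = 1 := by rw [hs]; field_simp
  have h7 : 0 < Real.log Y * Real.exp Real.eulerMascheroniConstant := by positivity
  have h8 := mul_le_mul_of_nonneg_left h5 h7.le
  refine le_trans (le_of_eq ?_) h8
  linear_combination (Real.exp Real.eulerMascheroniConstant * (C1 + C2)) * h6

noncomputable def invHom : ℕ →* ℝ where
  toFun n := (n : ℝ)⁻¹
  map_one' := by simp
  map_mul' a b := by push_cast; rw [mul_inv]

noncomputable def invSqrtHom : ℕ →* ℝ where
  toFun n := (Real.sqrt n)⁻¹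
  map_one' := by simp
  map_mul' a b := by push_cast; rw [Real.sqrt_mul (Nat.cast_nonneg a), mul_inv]

open Classical in
lemma smooth_sum (Y N : ℕ) (hN : 1 ≤ N) :
    ∏ p ∈ Nat.primesBelow (Y + 1), (1 - (p : ℝ)⁻¹)⁻¹ - 4 ^ Y / Real.sqrt N ≤
      ∑ n ∈ (Finset.Icc 1 N).filter (fun n => n ∈ Nat.smoothNumbers (Y + 1)), 1 / (n : ℝ) := by
  have hf : ∀ {p : ℕ}, p.Prime → ‖invHom p‖ < 1 := by
    intro p hp
    have : (1:ℝ) < p := by exact_mod_cast hp.one_lt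
    simp only [invHom, MonoidHom.coe_mk, OneHom.coe_mk, norm_inv, Real.norm_natCast]
    exact inv_lt_one_of_one_lt₀ this
  have hsq : ∀ {p : ℕ}, p.Prime → (4/3:ℝ) ≤ Real.sqrt p := by
    intro p hp
    have : (2:ℝ) ≤ p := by exact_mod_cast hp.two_le
    apply Real.le_sqrt_of_sq_le
    norm_num
    linarith
  have hg : ∀ {p : ℕ}, p.Prime → ‖invSqrtHom p‖ < 1 := by
    intro p hp
    simp only [invSqrtHom, MonoidHom.coe_mk, OneHom.coe_mk, norm_inv, Real.norm_eq_abs]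
    rw [abs_of_nonneg (Real.sqrt_nonneg _)]
    exact inv_lt_one_of_one_lt₀ (by linarith [hsq hp])
  have h1 := (EulerProduct.summable_and_hasSum_smoothNumbers_prod_primesBelow_geometric hf (Y+1)).2
  have h2 := (EulerProduct.summable_and_hasSum_smoothNumbers_prod_primesBelow_geometric hg (Y+1)).2
  replace h1 := (hasSum_subtype_iff_indicator (f := fun n : ℕ => invHom n)).1 h1
  replace h2 := (hasSum_subtype_iff_indicator (f := fun n : ℕ => invSqrtHom n)).1 h2
  have hNs : 0 < Real.sqrt N := Real.sqrt_pos.2 (by exact_mod_cast hN)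
  have h3 := h2.mul_left (Real.sqrt N)⁻¹
  set F := (Finset.Icc 1 N).filter (fun n => n ∈ Nat.smoothNumbers (Y + 1)) with hF
  have h4 : HasSum (fun n : ℕ => if n ∈ F then 1 / (n:ℝ) else 0) (∑ n ∈ F, 1 / (n:ℝ)) := by
    have := hasSum_sum_of_ne_finset_zero (f := fun n : ℕ => if n ∈ F then 1 / (n:ℝ) else 0) (s := F)
      (L := SummationFilter.unconditional ℕ)
      (by intro b hb; simp [hb])
    convert this using 1
    apply Finset.sum_congr rfl
    intro n hn; simp [hn]
  have h5 := hasSum_le (f := Set.indicator (Nat.smoothNumbers (Y+1)) (fun n : ℕ => invHom n)) (g := fun n : ℕ => (if n ∈ F then 1 / (n:ℝ) else 0) + (Real.sqrt N)⁻¹ * Set.indicator (Nat.smoothNumbers (Y+1)) (fun n : ℕ => invSqrtHom n) n) ?_ h1 (h4.add h3)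
  · have h6 : ∏ p ∈ Nat.primesBelow (Y + 1), (1 - invSqrtHom p)⁻¹ ≤ 4 ^ Y := by
      calc _ ≤ ∏ p ∈ Nat.primesBelow (Y + 1), (4:ℝ) := by
            apply Finset.prod_le_prod
            · intro p hp
              have hpp := Nat.prime_of_mem_primesBelow hp
              have := hg hpp
              have := (abs_lt.1 this).2
              exact inv_nonneg.2 (by linarith)
            · intro p hp
              have hpp := Nat.prime_of_mem_primesBelow hp
              have h := hsq hpp
              have : invSqrtHom p ≤ 3/4 := by
                change (Real.sqrt p)⁻¹ ≤ 3/4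
                rw [inv_le_comm₀ (by linarith) (by norm_num)]
                norm_num; linarith
              calc (1 - invSqrtHom p)⁻¹ ≤ (1/4:ℝ)⁻¹ := inv_anti₀ (by norm_num) (by linarith)
                _ = 4 := by norm_num
        _ = 4 ^ (Nat.primesBelow (Y+1)).card := by rw [Finset.prod_const]
        _ ≤ 4 ^ Y := by
            apply pow_le_pow_right₀ (by norm_num)
            have : Nat.primesBelow (Y+1) ⊆ Finset.Icc 1 Y := by
              intro p hp
              have hpp := Nat.prime_of_mem_primesBelow hp
              have := Nat.lt_of_mem_primesBelow hp
              simp [hpp.one_le]; omega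
            simpa using Finset.card_le_card this
    have h7 : (Real.sqrt N)⁻¹ * ∏ p ∈ Nat.primesBelow (Y + 1), (1 - invSqrtHom p)⁻¹ ≤ 4 ^ Y / Real.sqrt N := by
      rw [div_eq_inv_mul]
      gcongr
    have h8 : ∏ p ∈ Nat.primesBelow (Y + 1), (1 - (p : ℝ)⁻¹)⁻¹ = ∏ p ∈ Nat.primesBelow (Y + 1), (1 - invHom p)⁻¹ := rfl
    linarith
  · intro n
    by_cases hn : n ∈ Nat.smoothNumbers (Y+1)
    · simp only [Set.indicator_of_mem hn]
      have hn0 : n ≠ 0 := Nat.ne_zero_of_mem_smoothNumbers hn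
      by_cases hnN : n ≤ N
      · have : n ∈ F := by
          rw [hF, Finset.mem_filter, Finset.mem_Icc]
          exact ⟨⟨by omega, hnN⟩, hn⟩
        simp only [this, if_true]
        have e : invHom n = 1 / (n:ℝ) := by simp [invHom]
        rw [e]
        have : 0 ≤ invSqrtHom n := inv_nonneg.2 (Real.sqrt_nonneg _)
        have := mul_nonneg (inv_nonneg.2 hNs.le) this
        linarith
      · have : n ∉ F := by
          rw [hF, Finset.mem_filter, Finset.mem_Icc]
          intro h; exact hnN h.1.2
        simp only [this, if_false, zero_add]
        change (n:ℝ)⁻¹ ≤ (Real.sqrt N)⁻¹ * (Real.sqrt n)⁻¹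
        have hnn : Real.sqrt N ≤ Real.sqrt n := Real.sqrt_le_sqrt (by exact_mod_cast (by omega : N ≤ n))
        rw [← mul_inv]
        apply inv_anti₀ (mul_pos hNs (lt_of_lt_of_le hNs hnn))
        calc Real.sqrt N * Real.sqrt n ≤ Real.sqrt n * Real.sqrt n := by gcongr
          _ = n := Real.mul_self_sqrt (Nat.cast_nonneg n)
    · have : n ∉ F := by
          rw [hF, Finset.mem_filter]
          intro h; exact hn h.2
      simp [Set.indicator_of_notMem hn, this]

lemma odd_dk (P k : ℕ) : Odd (1 + 8 * P * k) := ⟨4 * P * k, by ring⟩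

lemma jac_periodic (P n : ℕ) : Function.Periodic (fun k : ℕ => jacobiSym (n:ℤ) (1 + 8 * P * k)) n := by
  intro k
  change jacobiSym (n:ℤ) (1 + 8 * P * (k + n)) = jacobiSym (n:ℤ) (1 + 8 * P * k)
  rw [jacobiSym.mod_right _ (odd_dk P (k+n)), jacobiSym.mod_right _ (odd_dk P k)]
  congr 1
  rw [Int.natAbs_natCast]
  have : 1 + 8 * P * (k + n) = 1 + 8 * P * k + (4 * n) * (2 * P) := by ring
  rw [this, Nat.add_mul_mod_self_left]

lemma jac_abs_le (a : ℤ) (b : ℕ) : -1 ≤ jacobiSym a b ∧ jacobiSym a b ≤ 1 := by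
  rcases jacobiSym.trichotomy a b with h | h | h <;> rw [h] <;> norm_num

lemma jac_period_sum (P n : ℕ) (hn : 1 ≤ n) :
    0 ≤ ∑ k ∈ Finset.range n, jacobiSym (n:ℤ) (1 + 8 * P * k) := by
  by_cases h : ∃ j, jacobiSym (n:ℤ) (1 + 8 * P * j) = -1
  swap
  · apply Finset.sum_nonneg
    intro k _
    rcases jacobiSym.trichotomy (n:ℤ) (1 + 8 * P * k) with h1 | h1 | h1
    · rw [h1]
    · rw [h1]; norm_num
    · exact absurd ⟨k, h1⟩ h
  obtain ⟨j, hj⟩ := h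
  haveI : NeZero n := ⟨by omega⟩
  set f : ℕ → ℤ := fun k => jacobiSym (n:ℤ) (1 + 8 * P * k) with hf
  have hper : Function.Periodic f n := jac_periodic P n
  have hval : ∀ k : ℕ, f ((k : ZMod n)).val = f k := by
    intro k
    rw [ZMod.val_natCast]
    exact hper.map_mod_nat k
  have hsum : ∑ k ∈ Finset.range n, f k = ∑ x : ZMod n, f x.val := by
    rw [Finset.sum_range]
    obtain ⟨m, rfl⟩ : ∃ m, n = m + 1 := ⟨n - 1, by omega⟩
    rfl
  have hcop : Nat.Coprime (1 + 8 * P * j) n := by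
    by_contra hc
    have : jacobiSym (n:ℤ) (1 + 8 * P * j) = 0 := by
      haveI : NeZero (1 + 8 * P * j) := ⟨by omega⟩
      rw [jacobiSym.eq_zero_iff_not_coprime]
      rw [Int.gcd_natCast_natCast]
      intro h
      exact hc (Nat.Coprime.symm h)
    rw [hj] at this
    norm_num at this
  let u := ZMod.unitOfCoprime _ hcop
  have hmul : ∀ k : ℕ, f (j + (1 + 8 * P * j) * k) = - f k := by
    intro k
    simp only [hf]
    have : 1 + 8 * P * (j + (1 + 8 * P * j) * k) = (1 + 8 * P * j) * (1 + 8 * P * k) := by ring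
    rw [this, jacobiSym.mul_right' _ (by omega) (by omega), hj]
    ring
  have key : ∑ x : ZMod n, f x.val = - ∑ x : ZMod n, f x.val := by
    rw [← Finset.sum_neg_distrib]
    symm
    refine Fintype.sum_equiv ((Units.mulLeft u).trans (Equiv.addLeft (j : ZMod n))) _ _ ?_
    intro x
    rw [← hmul, ← hval]
    congr 2
    simp [u, Units.mulLeft]
  rw [hsum]
  omega

lemma jac_sum_lower (P n : ℕ) (hn : 1 ≤ n) (K : ℕ) :
    -(n:ℤ) ≤ ∑ k ∈ Finset.range K, jacobiSym (n:ℤ) (1 + 8 * P * k) := by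
  induction K using Nat.strong_induction_on with
  | _ K ih =>
    by_cases hK : K < n
    · have : ∑ k ∈ Finset.range K, (-1:ℤ) ≤ ∑ k ∈ Finset.range K, jacobiSym (n:ℤ) (1 + 8 * P * k) :=
        Finset.sum_le_sum (fun k _ => (jac_abs_le _ _).1)
      simp at this
      omega
    · obtain ⟨m, rfl⟩ : ∃ m, K = n + m := ⟨K - n, by omega⟩
      rw [Finset.sum_range_add]
      have h1 := jac_period_sum P n hn
      have h2 := ih m (by omega)
      have h3 : ∑ x ∈ Finset.range m, jacobiSym (n:ℤ) (1 + 8 * P * (n + x)) = ∑ x ∈ Finset.range m, jacobiSym (n:ℤ) (1 + 8 * P * x) := by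
        apply Finset.sum_congr rfl
        intro x _
        rw [add_comm n x]
        exact jac_periodic P n x
      rw [h3]
      omega

lemma jac_sum_lower' (P n : ℕ) (hn : 1 ≤ n) (K : ℕ) :
    -(2 * n:ℤ) ≤ ∑ k ∈ Finset.Icc 1 K, jacobiSym (n:ℤ) (1 + 8 * P * k) := by
  have h := jac_sum_lower P n hn (K + 1)
  have e : Finset.range (K+1) = insert 0 (Finset.Icc 1 K) := by
    ext x; simp; omega
  rw [e, Finset.sum_insert (by simp)] at h
  simp at h ⊢
  omega

lemma jac_smooth (P Y k : ℕ) (hP : ∀ p : ℕ, p.Prime → p ≤ Y → p ∣ P) (n : ℕ)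
    (hn : n ∈ Nat.smoothNumbers (Y + 1)) : jacobiSym (n:ℤ) (1 + 8 * P * k) = 1 := by
  induction n using Nat.strong_induction_on with
  | _ n ih =>
    have hn0 : n ≠ 0 := Nat.ne_zero_of_mem_smoothNumbers hn
    by_cases h1 : n = 1
    · subst h1; simp
    have hp := Nat.minFac_prime h1
    set p := n.minFac with hpdef
    obtain ⟨m, hm⟩ := Nat.minFac_dvd n
    rw [← hpdef] at hm
    have hpY : p < Y + 1 := by
      rw [Nat.mem_smoothNumbers'] at hn
      exact hn p hp (Nat.minFac_dvd n)
    have hm0 : m ≠ 0 := by rintro rfl; simp at hm; exact hn0 hm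
    have hms : m ∈ Nat.smoothNumbers (Y+1) := Nat.mem_smoothNumbers_of_dvd hn ⟨p, by rw [hm]; ring⟩
    have hmlt : m < n := by
      rw [hm]; nlinarith [hp.two_le, Nat.pos_of_ne_zero hm0]
    rw [hm]
    push_cast
    rw [jacobiSym.mul_left, ih m hmlt hms, mul_one]
    obtain ⟨q, hq⟩ := hP p hp (by omega)
    rw [jacobiSym.mod_right _ (odd_dk P k), Int.natAbs_natCast]
    have : 1 + 8 * P * k = 1 + (4 * p) * (2 * q * k) := by rw [hq]; ring
    rw [this, Nat.add_mul_mod_self_left]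
    have h := jacobiSym.mod_right (p:ℤ) (b := 1) odd_one
    rw [Int.natAbs_natCast] at h
    rw [← h, jacobiSym.one_right]

noncomputable def Fsum (N d : ℕ) : ℝ := ∑ n ∈ Finset.Icc 1 N, (jacobiSym (n:ℤ) d : ℝ) / n

open Classical in
lemma first_moment (P Y K N : ℕ) (hP : ∀ p : ℕ, p.Prime → p ≤ Y → p ∣ P) :
    (K : ℝ) * (∑ n ∈ (Finset.Icc 1 N).filter (fun n => n ∈ Nat.smoothNumbers (Y + 1)), 1 / (n : ℝ))
      - 2 * N ≤ ∑ k ∈ Finset.Icc 1 K, Fsum N (1 + 8 * P * k) := by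
  unfold Fsum
  rw [Finset.sum_comm]
  rw [Finset.sum_filter, Finset.mul_sum]
  have h2 : (2 * N : ℝ) = ∑ n ∈ Finset.Icc 1 N, (2:ℝ) := by simp; ring
  rw [h2, ← Finset.sum_sub_distrib]
  apply Finset.sum_le_sum
  intro n hn
  have hn1 := (Finset.mem_Icc.1 hn).1
  have hnr : (0:ℝ) < n := by exact_mod_cast hn1
  rw [← Finset.sum_div, ← Int.cast_sum]
  split_ifs with hs
  · have : ∑ k ∈ Finset.Icc 1 K, jacobiSym (n:ℤ) (1 + 8 * P * k) = K := by
      rw [Finset.sum_congr rfl (fun k _ => jac_smooth P Y k hP n hs)]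
      simp
    rw [this]
    push_cast
    rw [mul_one_div]
    linarith
  · have := jac_sum_lower' P n hn1 K
    have : (-(2 * n : ℝ)) ≤ ((∑ k ∈ Finset.Icc 1 K, jacobiSym (n:ℤ) (1 + 8 * P * k) : ℤ) : ℝ) := by
      exact_mod_cast this
    rw [mul_zero, zero_sub, le_div_iff₀ hnr]
    linarith

lemma harm_le (N : ℕ) : ∑ n ∈ Finset.Icc 1 N, 1 / (n:ℝ) ≤ 1 + Real.log N := by
  have := harmonic_le_one_add_log N
  rw [harmonic_eq_sum_Icc] at this
  push_cast at this
  simpa [one_div] using this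

lemma Fsum_le (N d : ℕ) : Fsum N d ≤ 1 + Real.log N := by
  refine le_trans ?_ (harm_le N)
  apply Finset.sum_le_sum
  intro n _
  have : (jacobiSym (n:ℤ) d : ℝ) ≤ 1 := by exact_mod_cast (jac_abs_le _ _).2
  gcongr

lemma count_class (P K p : ℕ) (hp : p.Prime) :
    (((Finset.Icc 1 K).filter (fun k => p * p ∣ 1 + 8 * P * k)).card : ℝ) ≤ K * ((p:ℝ)^2)⁻¹ + 1 := by
  have hpp : 0 < p * p := Nat.mul_pos hp.pos hp.pos
  have h : ((Finset.Icc 1 K).filter (fun k => p * p ∣ 1 + 8 * P * k)).card ≤ (Finset.range (K / (p*p) + 1)).card := by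
    apply Finset.card_le_card_of_injOn (fun k => k / (p * p))
    · intro k hk
      simp only [Finset.coe_filter, Finset.mem_Icc, Set.mem_ofPred_eq] at hk
      simp only [Finset.coe_range, Set.mem_Iio]
      have := Nat.div_le_div_right (c := p * p) hk.1.2
      omega
    · intro k hk l hl hkl
      simp only [Finset.coe_filter, Finset.mem_Icc, Set.mem_ofPred_eq] at hk hl
      simp only at hkl
      have hcop : IsCoprime ((p * p : ℕ) : ℤ) ((8 * P : ℕ) : ℤ) := by
        rw [Nat.isCoprime_iff_coprime]
        have : Nat.Coprime p (8 * P) := by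
          rw [hp.coprime_iff_not_dvd]
          intro hd
          have h1 : p ∣ 1 + 8 * P * k := (dvd_mul_right p p).trans hk.2
          have h2 : p ∣ 1 := (Nat.dvd_add_left (hd.mul_right k)).1 h1
          exact hp.one_lt.ne' (Nat.dvd_one.1 h2)
        exact Nat.Coprime.mul_left this this
      have h1 : ((p * p : ℕ) : ℤ) ∣ ((8 * P : ℕ) : ℤ) * ((k:ℤ) - l) := by
        have a := Int.natCast_dvd_natCast.2 hk.2
        have b := Int.natCast_dvd_natCast.2 hl.2
        have c := dvd_sub a b
        have e : ((1 + 8 * P * k : ℕ) : ℤ) - ((1 + 8 * P * l : ℕ) : ℤ) = ((8 * P : ℕ) : ℤ) * ((k:ℤ) - l) := by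
          push_cast; ring
        rwa [e] at c
      have h2 := hcop.dvd_of_dvd_mul_left h1
      have h3 : l % (p*p) = k % (p*p) := (Nat.modEq_iff_dvd).2 h2
      rw [← Nat.div_add_mod k (p*p), ← Nat.div_add_mod l (p*p), hkl, h3]
  rw [Finset.card_range] at h
  have h2 : ((K / (p*p) : ℕ) : ℝ) ≤ K / ((p * p : ℕ) : ℝ) := Nat.cast_div_le
  have h3 : (((Finset.Icc 1 K).filter (fun k => p * p ∣ 1 + 8 * P * k)).card : ℝ) ≤ ((K / (p*p) : ℕ) : ℝ) + 1 := by
    exact_mod_cast h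
  rw [← div_eq_mul_inv]
  push_cast at h2
  rw [← sq (p:ℝ)] at h2
  linarith

open Classical in
lemma nonsqfree_count (P Y K : ℕ) (hP : ∀ p : ℕ, p.Prime → p ≤ Y → p ∣ P) :
    (((Finset.Icc 1 K).filter (fun k => ¬ Squarefree (1 + 8 * P * k))).card : ℝ) ≤
      2 * K / (Y + 1) + Nat.sqrt (1 + 8 * P * K) := by
  set R := Nat.sqrt (1 + 8 * P * K) with hR
  have hsub : (Finset.Icc 1 K).filter (fun k => ¬ Squarefree (1 + 8 * P * k)) ⊆
      ((Finset.Ioo Y (R+1)).filter Nat.Prime).biUnion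
        (fun p => (Finset.Icc 1 K).filter (fun k => p * p ∣ 1 + 8 * P * k)) := by
    intro k hk
    rw [Finset.mem_filter, Finset.mem_Icc, Nat.squarefree_iff_prime_squarefree] at hk
    obtain ⟨hk1, hk2⟩ := hk
    push Not at hk2
    obtain ⟨p, hp, hd⟩ := hk2
    rw [Finset.mem_biUnion]
    refine ⟨p, ?_, ?_⟩
    · rw [Finset.mem_filter, Finset.mem_Ioo]
      refine ⟨⟨?_, ?_⟩, hp⟩
      · by_contra hY
        have h1 : p ∣ 1 + 8 * P * k := (dvd_mul_right p p).trans hd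
        have h2 : p ∣ 1 := (Nat.dvd_add_left (((hP p hp (by omega)).mul_left 8).mul_right k)).1 h1
        exact hp.one_lt.ne' (Nat.dvd_one.1 h2)
      · have : p * p ≤ 1 + 8 * P * K := (Nat.le_of_dvd (by omega) hd).trans (by gcongr; exact hk1.2)
        have := Nat.le_sqrt.2 this
        omega
    · rw [Finset.mem_filter, Finset.mem_Icc]
      exact ⟨hk1, hd⟩
  have h1 := (Finset.card_le_card hsub).trans Finset.card_biUnion_le
  calc (((Finset.Icc 1 K).filter (fun k => ¬ Squarefree (1 + 8 * P * k))).card : ℝ)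
      ≤ ∑ p ∈ (Finset.Ioo Y (R+1)).filter Nat.Prime, (((Finset.Icc 1 K).filter (fun k => p * p ∣ 1 + 8 * P * k)).card : ℝ) := by
        exact_mod_cast h1
    _ ≤ ∑ p ∈ (Finset.Ioo Y (R+1)).filter Nat.Prime, (K * ((p:ℝ)^2)⁻¹ + 1) := by
        apply Finset.sum_le_sum
        intro p hp
        exact count_class P K p (Finset.mem_filter.1 hp).2
    _ ≤ ∑ p ∈ Finset.Ioo Y (R+1), (K * ((p:ℝ)^2)⁻¹ + 1) := by
        apply Finset.sum_le_sum_of_subset_of_nonneg (Finset.filter_subset _ _)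
        intros; positivity
    _ = K * ∑ p ∈ Finset.Ioo Y (R+1), ((p:ℝ)^2)⁻¹ + ((R + 1 - Y - 1 : ℕ) : ℝ) := by
        rw [Finset.sum_add_distrib, Finset.mul_sum]; simp
    _ ≤ K * (2 / (Y + 1)) + R := by
        gcongr
        · exact sum_Ioo_inv_sq_le Y (R+1)
        · omega
    _ = _ := by ring

noncomputable def jacChar (d : ℕ) [NeZero d] : DirichletCharacter ℂ d where
  toFun x := (jacobiSym (x.val : ℤ) d : ℂ)
  map_one' := by
    have h : ((1 : ZMod d).val : ℤ) = (1:ℤ) % d := by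
      have := ZMod.val_intCast (n := d) 1
      simpa using this
    rw [h, ← jacobiSym.mod_left]; simp
  map_mul' x y := by
    rw [ZMod.val_mul]
    push_cast
    rw [← jacobiSym.mod_left, jacobiSym.mul_left]
    push_cast; rfl
  map_nonunit' x hx := by
    have : jacobiSym (x.val : ℤ) d = 0 := by
      rw [jacobiSym.eq_zero_iff_not_coprime, Int.gcd_natCast_natCast]
      intro h
      apply hx
      have := (ZMod.isUnit_iff_coprime x.val d).2 h
      rwa [ZMod.natCast_zmod_val] at this
    change (jacobiSym (x.val : ℤ) d : ℂ) = 0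
    rw [this, Int.cast_zero]

lemma jacChar_natCast (d : ℕ) [NeZero d] (n : ℕ) : jacChar d (n : ZMod d) = (jacobiSym (n:ℤ) d : ℂ) := by
  change (jacobiSym ((n : ZMod d).val : ℤ) d : ℂ) = _
  rw [ZMod.val_natCast]
  push_cast
  rw [← jacobiSym.mod_left]

lemma jacChar_quadratic (d : ℕ) [NeZero d] : MulChar.IsQuadratic (jacChar d) := by
  intro x
  change (jacobiSym (x.val : ℤ) d : ℂ) = 0 ∨ (jacobiSym (x.val : ℤ) d : ℂ) = 1 ∨ (jacobiSym (x.val : ℤ) d : ℂ) = -1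
  rcases jacobiSym.trichotomy (x.val : ℤ) d with h | h | h <;> rw [h] <;> simp

lemma jacChar_primitive (d : ℕ) [NeZero d] (hodd : Odd d) (hsq : Squarefree d) : (jacChar d).IsPrimitive := by
  rw [DirichletCharacter.isPrimitive_def]
  by_contra hne
  obtain ⟨e, he⟩ := (jacChar d).conductor_dvd_level
  have he1 : e ≠ 1 := by
    rintro rfl
    rw [mul_one] at he
    exact hne he.symm
  obtain ⟨p, hp, q, hq⟩ := Nat.exists_prime_and_dvd he1
  set m := (jacChar d).conductor * q with hm
  have hdm : d = p * m := by rw [he, hq, hm]; ring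
  have hm0 : m ≠ 0 := by
    rintro h
    rw [h, mul_zero] at hdm
    exact NeZero.ne d hdm
  have hcop : Nat.Coprime p m := by
    rw [hdm] at hsq
    exact Nat.coprime_of_squarefree_mul hsq
  have hmd : m ∣ d := ⟨p, by rw [hdm]; ring⟩
  have hft : (jacChar d).FactorsThrough m :=
    (jacChar d).factorsThrough_conductor.mono _ ⟨q, rfl⟩ hmd
  rw [DirichletCharacter.factorsThrough_iff_ker_unitsMap hmd] at hft
  have hp2 : p ≠ 2 := by
    rintro rfl
    exact (Nat.not_even_iff_odd.2 hodd) ⟨m, by rw [hdm]; ring⟩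
  have : Fact p.Prime := ⟨hp⟩
  obtain ⟨a, ha⟩ := quadraticChar_exists_neg_one (F := ZMod p) (by rwa [ZMod.ringChar_zmod_n])
  obtain ⟨n, hn1, hn2⟩ := Nat.chineseRemainder hcop a.val 1
  have hJ : jacobiSym (n:ℤ) d = -1 := by
    rw [hdm, jacobiSym.mul_right' _ hp.ne_zero hm0]
    have h1 : jacobiSym (n:ℤ) p = -1 := by
      rw [← jacobiSym.legendreSym.to_jacobiSym]
      unfold legendreSym
      have : ((n:ℤ) : ZMod p) = a := by
        have := (ZMod.natCast_eq_natCast_iff _ _ _).2 hn1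
        rw [ZMod.natCast_zmod_val] at this
        exact_mod_cast this
      rw [this, ha]
    have h2 : jacobiSym (n:ℤ) m = 1 := by
      have : (n:ℤ) % m = 1 % m := by exact_mod_cast hn2
      rw [jacobiSym.mod_left, this, ← jacobiSym.mod_left, jacobiSym.one_left]
    rw [h1, h2]; norm_num
  have hnd : Nat.Coprime n d := by
    by_contra h
    have : jacobiSym (n:ℤ) d = 0 := by
      rw [jacobiSym.eq_zero_iff_not_coprime, Int.gcd_natCast_natCast]
      exact h
    rw [hJ] at this; norm_num at this
  let u := ZMod.unitOfCoprime n hnd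
  have hu : u ∈ (ZMod.unitsMap hmd).ker := by
    rw [MonoidHom.mem_ker]
    ext
    simp only [ZMod.unitsMap_def, u, Units.coe_map, MonoidHom.coe_coe, ZMod.coe_unitOfCoprime, Units.val_one, map_natCast]
    have := (ZMod.natCast_eq_natCast_iff _ _ _).2 hn2
    simpa using this
  have h := hft hu
  rw [MonoidHom.mem_ker, Units.ext_iff, MulChar.coe_toUnitHom] at h
  simp only [u, ZMod.coe_unitOfCoprime, Units.val_one] at h
  rw [jacChar_natCast, hJ] at h
  norm_num at h

lemma sum_zmod_val (d : ℕ) [NeZero d] (f : ℕ → ℝ) : ∑ x : ZMod d, f x.val = ∑ k ∈ Finset.range d, f k := by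
  rw [Finset.sum_range]
  obtain ⟨m, rfl⟩ : ∃ m, d = m + 1 := ⟨d - 1, by have := NeZero.pos d; omega⟩
  rfl

lemma gauss_norm (d : ℕ) [NeZero d] (χ : DirichletCharacter ℂ d) (hχ : χ.IsPrimitive)
    (hq : MulChar.IsQuadratic χ) (h1 : 1 < d) :
    (∀ j : ZMod d, (d:ℂ) * χ j = gaussSum χ ZMod.stdAddChar * ∑ k : ZMod d, χ k * ZMod.stdAddChar (k * (-j))) := by
  intro j
  have h := congrFun (ZMod.dft_dft (fun x => χ x)) (-j)
  rw [neg_neg] at h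
  have hF : ZMod.dft (fun x => χ x) = fun k => χ (-k) * gaussSum χ ZMod.stdAddChar := by
    funext k
    have := hχ.fourierTransform_eq_inv_mul_gaussSum k
    rw [hq.inv] at this
    exact this
  rw [hF, ZMod.dft_apply] at h
  rw [smul_eq_mul] at h
  rw [← h, Finset.mul_sum]
  refine Fintype.sum_equiv (Equiv.neg (ZMod d)) _ _ ?_
  intro k
  simp only [smul_eq_mul, Equiv.neg_apply]
  rw [show -(k * -j) = -k * -j by ring]
  ring

lemma gauss_norm_le (d : ℕ) [NeZero d] (χ : DirichletCharacter ℂ d) (hχ : χ.IsPrimitive)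
    (hq : MulChar.IsQuadratic χ) (h1 : 1 < d) :
    ‖gaussSum χ ZMod.stdAddChar‖ = Real.sqrt d := by
  have h := gauss_norm d χ hχ hq h1 (-1)
  have h2 : ∑ k : ZMod d, χ k * ZMod.stdAddChar (k * (- -1)) = gaussSum χ ZMod.stdAddChar := by
    unfold gaussSum
    simp
  rw [h2] at h
  have h3 := congrArg norm h
  rw [norm_mul, norm_mul, Complex.norm_natCast] at h3
  have h4 : ‖χ (-1)‖ = 1 := by
    rcases χ.even_or_odd with h | h
    · rw [h]; simp
    · rw [h]; simp
  rw [h4, mul_one, ← sq] at h3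
  rw [h3, Real.sqrt_sq (norm_nonneg _)]

lemma sin_lower (d k : ℕ) (hk : 0 < k) (hkd : k < d) :
    (Real.sin (Real.pi * k / d))⁻¹ ≤ d / 2 * (1 / (k:ℝ) + 1 / ((d - k : ℕ) : ℝ)) := by
  have hk' : (0:ℝ) < k := by exact_mod_cast hk
  have hd' : (0:ℝ) < d := by exact_mod_cast (by omega : 0 < d)
  have hdk' : (0:ℝ) < ((d - k : ℕ) : ℝ) := by exact_mod_cast (by omega : 0 < d - k)
  have hpi := Real.pi_pos
  have e : ((d - k : ℕ) : ℝ) = d - k := by push_cast [hkd.le]; ring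
  rcases le_total (2 * k) d with h | h
  · have h' : (2 * k : ℝ) ≤ d := by exact_mod_cast h
    have h2 := Real.mul_le_sin (x := Real.pi * k / d) (by positivity) (by
      rw [div_le_div_iff₀ hd' (by norm_num)]; nlinarith)
    have h3 : 2 / Real.pi * (Real.pi * k / d) = 2 * k / d := by field_simp
    rw [h3] at h2
    calc _ ≤ (2 * k / d : ℝ)⁻¹ := inv_anti₀ (by positivity) h2
      _ = d / 2 * (1 / (k:ℝ)) := by field_simp
      _ ≤ _ := by gcongr; simp
  · have h' : (d : ℝ) ≤ 2 * k := by exact_mod_cast h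
    have h2 := Real.mul_le_sin (x := Real.pi * ((d - k : ℕ) : ℝ) / d) (by positivity) (by
      rw [div_le_div_iff₀ hd' (by norm_num), e]; nlinarith)
    have h3 : 2 / Real.pi * (Real.pi * ((d - k : ℕ) : ℝ) / d) = 2 * ((d - k : ℕ) : ℝ) / d := by field_simp
    have h4 : Real.sin (Real.pi * ((d - k : ℕ) : ℝ) / d) = Real.sin (Real.pi * k / d) := by
      rw [← Real.sin_pi_sub]; congr 1; rw [e]; field_simp; ring
    rw [h3, h4] at h2
    calc _ ≤ (2 * ((d - k : ℕ) : ℝ) / d : ℝ)⁻¹ := inv_anti₀ (by positivity) h2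
      _ = d / 2 * (1 / ((d - k : ℕ) : ℝ)) := by field_simp
      _ ≤ _ := by gcongr; simp

lemma geom_bound (d k m : ℕ) [NeZero d] (hk : 0 < k) (hkd : k < d) :
    ‖∑ j ∈ Finset.range m, (ZMod.stdAddChar (-((k:ZMod d) * (j:ZMod d))) : ℂ)‖ ≤ d / 2 * (1 / (k:ℝ) + 1 / ((d - k : ℕ) : ℝ)) := by
  refine le_trans ?_ (sin_lower d k hk hkd)
  set z : ℂ := ZMod.stdAddChar (-(k:ZMod d)) with hz
  have h1 : ∀ j : ℕ, (ZMod.stdAddChar (-((k:ZMod d) * (j:ZMod d))) : ℂ) = z ^ j := by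
    intro j
    rw [hz, ← AddChar.map_nsmul_eq_pow]
    congr 1
    simp; ring
  simp_rw [h1]
  have hd' : (0:ℝ) < d := by exact_mod_cast (by omega : 0 < d)
  have hk' : (0:ℝ) < k := by exact_mod_cast hk
  have hkd' : (k:ℝ) < d := by exact_mod_cast hkd
  have hzn : ‖z‖ = 1 := by rw [hz, ZMod.stdAddChar_apply]; exact Circle.norm_coe _
  have hsin : 0 < Real.sin (Real.pi * k / d) := by
    apply Real.sin_pos_of_pos_of_lt_pi
    · have := Real.pi_pos; positivity
    · rw [div_lt_iff₀ hd']; exact mul_lt_mul_of_pos_left hkd' Real.pi_pos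
  have hz1 : ‖z - 1‖ = 2 * Real.sin (Real.pi * k / d) := by
    have e : z = Complex.exp (Complex.I * ((-(2 * Real.pi * k / d) : ℝ) : ℂ)) := by
      rw [hz]
      have := ZMod.stdAddChar_coe (N := d) (-(k:ℤ))
      push_cast at this
      rw [this]
      congr 1
      push_cast
      ring
    rw [e, Complex.norm_exp_I_mul_ofReal_sub_one]
    rw [show -(2 * Real.pi * k / d) / 2 = -(Real.pi * k / d) by ring, Real.sin_neg, norm_mul, norm_neg, Real.norm_eq_abs, Real.norm_eq_abs, abs_of_pos hsin]
    norm_num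
  have hne : z ≠ 1 := by
    intro h
    rw [h] at hz1
    simp at hz1
    exact hsin.ne' hz1
  rw [geom_sum_eq hne, norm_div, hz1]
  rw [div_le_iff₀ (by positivity)]
  calc ‖z ^ m - 1‖ ≤ ‖z^m‖ + ‖(1:ℂ)‖ := norm_sub_le _ _
    _ = 2 := by rw [norm_pow, hzn]; norm_num
    _ = _ := by field_simp

lemma polya_vinogradov (d : ℕ) [NeZero d] (χ : DirichletCharacter ℂ d) (hχ : χ.IsPrimitive)
    (hq : MulChar.IsQuadratic χ) (h1 : 1 < d) (m : ℕ) :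
    ‖∑ n ∈ Finset.range m, χ (n : ZMod d)‖ ≤ Real.sqrt d * (1 + Real.log d) := by
  have hd' : (0:ℝ) < d := by exact_mod_cast (by omega : 0 < d)
  have A := gauss_norm d χ hχ hq h1
  have hg := gauss_norm_le d χ hχ hq h1
  have h : (d:ℂ) * ∑ n ∈ Finset.range m, χ (n : ZMod d) =
      gaussSum χ ZMod.stdAddChar * ∑ k : ZMod d, χ k * ∑ n ∈ Finset.range m, ZMod.stdAddChar (-(k * (n : ZMod d))) := by
    rw [Finset.mul_sum]
    simp_rw [A, ← Finset.mul_sum]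
    congr 1
    rw [Finset.sum_comm]
    apply Finset.sum_congr rfl
    intro k _
    rw [Finset.mul_sum]
    simp_rw [mul_neg]
  have hb : ‖∑ k : ZMod d, χ k * ∑ n ∈ Finset.range m, (ZMod.stdAddChar (-(k * (n : ZMod d))) : ℂ)‖ ≤ d * (1 + Real.log d) := by
    refine (norm_sum_le _ _).trans ?_
    set w : ℕ → ℝ := fun k => if k = 0 then 0 else d / 2 * (1 / (k:ℝ) + 1 / ((d - k : ℕ) : ℝ)) with hw
    have h2 : ∀ k : ZMod d, ‖χ k * ∑ n ∈ Finset.range m, (ZMod.stdAddChar (-(k * (n : ZMod d))) : ℂ)‖ ≤ w k.val := by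
      intro k
      by_cases hk : k = 0
      · have : ¬ IsUnit (0 : ZMod d) := by
          have : Fact (1 < d) := ⟨h1⟩
          exact not_isUnit_zero
        rw [hk, χ.map_nonunit this]; simp [hw]
      · have hkv : k.val ≠ 0 := by rwa [Ne, ZMod.val_eq_zero]
        simp only [hw, hkv, if_false]
        rw [norm_mul]
        have h3 := geom_bound d k.val m (Nat.pos_of_ne_zero hkv) (ZMod.val_lt k)
        rw [ZMod.natCast_zmod_val] at h3
        have h4 := χ.norm_le_one k
        exact (mul_le_of_le_one_left (norm_nonneg _) h4).trans h3
    refine (Finset.sum_le_sum (fun k _ => h2 k)).trans ?_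
    rw [sum_zmod_val d w]
    have e1 : ∑ k ∈ Finset.range d, w k = ∑ k ∈ Finset.Ico 1 d, d / 2 * (1 / (k:ℝ) + 1 / ((d - k : ℕ) : ℝ)) := by
      rw [Finset.range_eq_Ico, Finset.sum_eq_sum_Ico_succ_bot (by omega)]
      simp only [hw, if_true, zero_add]
      apply Finset.sum_congr rfl
      intro k hk
      have := (Finset.mem_Ico.1 hk).1
      rw [if_neg (by omega)]
    rw [e1, ← Finset.mul_sum, Finset.sum_add_distrib]
    have e2 : ∑ k ∈ Finset.Ico 1 d, 1 / ((d - k : ℕ) : ℝ) = ∑ k ∈ Finset.Ico 1 d, 1 / (k:ℝ) := by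
      refine Finset.sum_nbij' (fun k => d - k) (fun k => d - k) ?_ ?_ ?_ ?_ ?_ <;> intro k hk <;>
        simp only [Finset.mem_Ico] at * <;> first | omega | rfl
    have e3 : ∑ k ∈ Finset.Ico 1 d, 1 / (k:ℝ) ≤ 1 + Real.log d := by
      have := harmonic_le_one_add_log d
      rw [harmonic_eq_sum_Icc] at this
      push_cast at this
      refine le_trans ?_ this
      simp_rw [one_div]
      apply Finset.sum_le_sum_of_subset_of_nonneg
      · intro k hk; simp only [Finset.mem_Ico, Finset.mem_Icc] at *; omega
      · intros; positivity
    rw [e2]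
    calc _ ≤ (d:ℝ) / 2 * ((1 + Real.log d) + (1 + Real.log d)) := by gcongr
      _ = _ := by ring
  have h5 := congrArg norm h
  rw [norm_mul, norm_mul, hg, Complex.norm_natCast] at h5
  have h6 : (d:ℝ) * ‖∑ n ∈ Finset.range m, χ (n : ZMod d)‖ ≤ d * (Real.sqrt d * (1 + Real.log d)) := by
    rw [h5]
    calc _ ≤ Real.sqrt d * (d * (1 + Real.log d)) := by gcongr
      _ = _ := by ring
  exact le_of_mul_le_mul_left h6 hd'

lemma trunc_s (d : ℕ) [NeZero d] (χ : DirichletCharacter ℂ d) (B : ℝ)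
    (hB : ∀ m, ‖∑ n ∈ Finset.range m, χ (n : ZMod d)‖ ≤ B) (N : ℕ) (s : ℝ) (hs : 1 < s) :
    ‖χ.LFunction (s:ℂ) - ∑ n ∈ Finset.Icc 1 N, (((n:ℝ) ^ (-s) : ℝ) : ℂ) * χ (n : ZMod d)‖ ≤ 2 * B / (N + 1) := by
  have hs' : 1 < ((s:ℂ)).re := by simpa using hs
  have hB0 : 0 ≤ B := (norm_nonneg _).trans (hB 0)
  rw [χ.LFunction_eq_LSeries hs']
  have hsum := (χ.LSeriesSummable_of_one_lt_re hs').hasSum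
  have ht := hsum.tendsto_sum_nat
  have ht2 := (ht.sub_const (∑ n ∈ Finset.Icc 1 N, (((n:ℝ) ^ (-s) : ℝ) : ℂ) * χ (n : ZMod d))).norm
  refine le_of_tendsto ht2 ?_
  filter_upwards [eventually_ge_atTop (N+1)] with m hm
  have hterm : ∀ n : ℕ, 1 ≤ n → LSeries.term (fun n => χ (n : ZMod d)) (s:ℂ) n = ((n:ℝ) ^ (-s)) • χ (n : ZMod d) := by
    intro n hn
    rw [LSeries.term_of_ne_zero (by omega), Complex.real_smul, Complex.ofReal_cpow (Nat.cast_nonneg n)]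
    rw [Complex.ofReal_neg, Complex.cpow_neg, Complex.ofReal_natCast]
    rw [div_eq_inv_mul]
  have e : ∑ n ∈ Finset.range m, LSeries.term (fun n => χ (n : ZMod d)) (s:ℂ) n =
      ∑ n ∈ Finset.Icc 1 N, (((n:ℝ) ^ (-s) : ℝ) : ℂ) * χ (n : ZMod d) +
      ∑ n ∈ Finset.Ico (N+1) m, ((n:ℝ) ^ (-s)) • χ (n : ZMod d) := by
    rw [Finset.range_eq_Ico, Finset.sum_eq_sum_Ico_succ_bot (by omega), LSeries.term_zero, zero_add]
    rw [← Finset.sum_Ico_consecutive _ (by omega : 1 ≤ N + 1) hm]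
    congr 1
    · have : Finset.Icc 1 N = Finset.Ico (0+1) (N+1) := by ext; simp
      rw [this]
      apply Finset.sum_congr rfl
      intro n hn
      rw [hterm n (by simp at hn; omega), Complex.real_smul]
    · apply Finset.sum_congr rfl
      intro n hn
      rw [hterm n (by simp at hn; omega)]
  rw [e, add_sub_cancel_left]
  have h := abel_bound (fun n : ℕ => χ (n : ZMod d)) (fun n => (n:ℝ) ^ (-s)) (N+1) m ?_ ?_ (2 * B) ?_
  · refine h.trans ?_
    rw [div_eq_mul_inv]
    gcongr
    have h1 : (1:ℝ) ≤ (N + 1 : ℕ) := by push_cast; linarith [Nat.cast_nonneg (α := ℝ) N]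
    calc ((N + 1 : ℕ) : ℝ) ^ (-s) ≤ ((N+1 : ℕ):ℝ) ^ (-1:ℝ) := Real.rpow_le_rpow_of_exponent_le h1 (by linarith)
      _ = _ := by rw [Real.rpow_neg_one]; push_cast; rfl
  · intro n hn
    apply Real.rpow_le_rpow_of_nonpos
    · exact_mod_cast (by omega : 0 < n)
    · push_cast; linarith
    · linarith
  · intro n hn; positivity
  · intro k
    rcases le_total (N+1) k with hk | hk
    · rw [Finset.sum_Ico_eq_sub _ hk]
      calc _ ≤ _ := norm_sub_le _ _
        _ ≤ B + B := add_le_add (hB _) (hB _)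
        _ = _ := by ring
    · rw [Finset.Ico_eq_empty_of_le hk]; simp [hB0]

lemma trunc_one (d : ℕ) [NeZero d] (χ : DirichletCharacter ℂ d) (hχ : χ ≠ 1) (B : ℝ)
    (hB : ∀ m, ‖∑ n ∈ Finset.range m, χ (n : ZMod d)‖ ≤ B) (N : ℕ) :
    ‖χ.LFunction 1 - ∑ n ∈ Finset.Icc 1 N, (((n:ℝ)⁻¹ : ℝ) : ℂ) * χ (n : ZMod d)‖ ≤ 2 * B / (N + 1) := by
  have hc : Continuous (fun s : ℝ => ‖χ.LFunction (s:ℂ) - ∑ n ∈ Finset.Icc 1 N, (((n:ℝ) ^ (-s) : ℝ) : ℂ) * χ (n : ZMod d)‖) := by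
    apply Continuous.norm
    apply Continuous.sub
    · exact (DirichletCharacter.differentiable_LFunction hχ).continuous.comp Complex.continuous_ofReal
    · apply continuous_finsetSum
      intro n hn
      have hn0 : (n:ℝ) ≠ 0 := by
        have := (Finset.mem_Icc.1 hn).1
        exact_mod_cast (by omega : n ≠ 0)
      apply Continuous.mul _ continuous_const
      apply Complex.continuous_ofReal.comp
      exact (Real.continuous_const_rpow hn0).comp continuous_neg
  have h1 := (hc.tendsto 1).mono_left (nhdsWithin_le_nhds (s := Set.Ioi 1))
  have h2 := le_of_tendsto h1 (eventually_nhdsWithin_of_forall (fun s hs => trunc_s d χ B hB N s hs))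
  simpa [Real.rpow_neg_one] using h2

lemma L_lower (d N : ℕ) [NeZero d] (hodd : Odd d) (hsq : Squarefree d) (h1 : 1 < d) :
    Fsum N d - 2 * (Real.sqrt d * (1 + Real.log d)) / (N + 1) ≤ ((jacChar d).LFunction 1).re := by
  have hp := jacChar_primitive d hodd hsq
  have hne : jacChar d ≠ 1 := by
    intro h
    rw [DirichletCharacter.isPrimitive_def, h, DirichletCharacter.conductor_one] at hp
    omega
  have h := trunc_one d (jacChar d) hne _ (polya_vinogradov d _ hp (jacChar_quadratic d) h1) N
  have e : ∑ n ∈ Finset.Icc 1 N, (((n:ℝ)⁻¹ : ℝ) : ℂ) * jacChar d (n : ZMod d) = ((Fsum N d : ℝ) : ℂ) := by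
    unfold Fsum
    rw [Complex.ofReal_sum]
    apply Finset.sum_congr rfl
    intro n _
    rw [jacChar_natCast]
    push_cast
    rw [div_eq_inv_mul]
  rw [e] at h
  have h2 := (Complex.abs_re_le_norm _).trans h
  rw [Complex.sub_re, Complex.ofReal_re] at h2
  have := (abs_le.1 h2).1
  linarith

open Classical in
lemma main_count (P Y K N : ℕ) (D T : ℝ) (hP0 : 0 < P)
    (hP : ∀ p : ℕ, p.Prime → p ≤ Y → p ∣ P) (hD1 : 1 ≤ D) (hKD : ((1 + 8 * P * K : ℕ) : ℝ) ≤ D)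
    (hE : 2 * (Real.sqrt D * (1 + Real.log D)) ≤ N + 1) (hT : 0 ≤ T + 1) :
    (K : ℝ) * (∑ n ∈ (Finset.Icc 1 N).filter (fun n => n ∈ Nat.smoothNumbers (Y + 1)), 1 / (n : ℝ))
      - 2 * N - (2 * K / (Y + 1) + Real.sqrt D) * (1 + Real.log N) - K * (T + 1) ≤
    (Nat.card {d : ℕ // (d : ℝ) ≤ D ∧ IsFundamentalDiscriminant d ∧
            ∃ χ : DirichletCharacter ℂ d, χ.IsPrimitive ∧ MulChar.IsQuadratic χ ∧
              T ≤ (LFun d χ 1).re} : ℝ) * (1 + Real.log N) := by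
  have hlogN : 0 ≤ 1 + Real.log N := by
    have := Real.log_natCast_nonneg N; linarith
  have hfm := first_moment P Y K N hP
  set Q : ℕ → Prop := fun d => (d : ℝ) ≤ D ∧ IsFundamentalDiscriminant d ∧
            ∃ χ : DirichletCharacter ℂ d, χ.IsPrimitive ∧ MulChar.IsQuadratic χ ∧
              T ≤ (LFun d χ 1).re with hQ
  set G := (Finset.Icc 1 K).filter (fun k => Q (1 + 8 * P * k)) with hG
  set W := (Finset.Icc 1 K).filter (fun k => ¬ Squarefree (1 + 8 * P * k)) with hW
  have hcard : (G.card : ℝ) ≤ Nat.card {d : ℕ // Q d} := by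
    have hfin : Finite {d : ℕ // Q d} := by
      apply Set.Finite.to_subtype (s := {d | Q d})
      apply (Set.finite_Iic ⌊D⌋₊).subset
      intro d hd
      exact Nat.le_floor hd.1
    have : Nat.card G ≤ Nat.card {d : ℕ // Q d} := by
      apply Nat.card_le_card_of_injective (fun k : G => (⟨1 + 8 * P * k.1, (Finset.mem_filter.1 k.2).2⟩ : {d : ℕ // Q d}))
      intro a b hab
      have h := congrArg Subtype.val hab
      simp only at h
      have : 8 * P * a.1 = 8 * P * b.1 := by omega
      exact Subtype.ext (Nat.eq_of_mul_eq_mul_left (by omega) this)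
    rw [Nat.card_eq_fintype_card, Fintype.card_coe] at this
    exact_mod_cast this
  have hWc : (W.card : ℝ) ≤ 2 * K / (Y + 1) + Real.sqrt D := by
    refine (nonsqfree_count P Y K hP).trans ?_
    gcongr
    apply Real.le_sqrt_of_sq_le
    refine le_trans ?_ hKD
    exact_mod_cast Nat.sqrt_le' _
  have hpt : ∀ k ∈ Finset.Icc 1 K, Fsum N (1 + 8 * P * k) ≤
      (if k ∈ W then 1 + Real.log N else 0) + (if k ∈ G then 1 + Real.log N else 0) + (T + 1) := by
    intro k hk
    have hF := Fsum_le N (1 + 8 * P * k)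
    by_cases hkW : k ∈ W
    · rw [if_pos hkW]
      split_ifs <;> linarith
    rw [if_neg hkW]
    by_cases hkG : k ∈ G
    · rw [if_pos hkG]; linarith
    rw [if_neg hkG]
    have hsq : Squarefree (1 + 8 * P * k) := by
      by_contra h
      exact hkW (Finset.mem_filter.2 ⟨hk, h⟩)
    have hk' := Finset.mem_Icc.1 hk
    have hNe : NeZero (1 + 8 * P * k) := ⟨by omega⟩
    have h1 : 1 < 1 + 8 * P * k := by
      have : 0 < 8 * P * k := Nat.mul_pos (by omega) (by omega)
      omega
    have hdD : ((1 + 8 * P * k : ℕ) : ℝ) ≤ D := by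
      refine le_trans ?_ hKD
      have : 1 + 8 * P * k ≤ 1 + 8 * P * K := by gcongr; exact hk'.2
      exact_mod_cast this
    have hL := L_lower (1 + 8 * P * k) N (odd_dk P k) hsq h1
    have hE2 : 2 * (Real.sqrt ((1 + 8 * P * k : ℕ) : ℝ) * (1 + Real.log ((1 + 8 * P * k : ℕ) : ℝ))) / (N + 1) ≤ 1 := by
      rw [div_le_one (by positivity)]
      refine le_trans ?_ hE
      have : Real.log ((1 + 8 * P * k : ℕ) : ℝ) ≤ Real.log D := Real.log_le_log (by positivity) hdD
      have := Real.log_natCast_nonneg (1 + 8 * P * k)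
      gcongr
    have hnotQ : ¬ Q (1 + 8 * P * k) := fun h => hkG (Finset.mem_filter.2 ⟨hk, h⟩)
    have : ((jacChar (1 + 8 * P * k)).LFunction 1).re < T := by
      by_contra hlt
      push Not at hlt
      apply hnotQ
      refine ⟨hdD, ⟨by omega, Or.inl ⟨?_, hsq⟩⟩, jacChar _, jacChar_primitive _ (odd_dk P k) hsq, jacChar_quadratic _, ?_⟩
      · have : 1 + 8 * P * k = 1 + 4 * (2 * P * k) := by ring
        rw [this]; omega
      · unfold LFun
        rw [dif_pos (NeZero.ne _)]
        exact hlt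
    linarith
  have hs := Finset.sum_le_sum hpt
  rw [Finset.sum_add_distrib, Finset.sum_add_distrib, Finset.sum_ite_mem, Finset.sum_ite_mem] at hs
  have e1 : Finset.Icc 1 K ∩ W = W := Finset.inter_eq_right.2 (Finset.filter_subset _ _)
  have e2 : Finset.Icc 1 K ∩ G = G := Finset.inter_eq_right.2 (Finset.filter_subset _ _)
  rw [e1, e2] at hs
  simp only [Finset.sum_const, nsmul_eq_mul, Nat.card_Icc, Nat.add_sub_cancel] at hs
  have a1 := mul_le_mul_of_nonneg_right hWc hlogN
  have a2 := mul_le_mul_of_nonneg_right hcard hlogN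
  linarith

lemma fund_card (D : ℝ) (hD : 1 ≤ D) :
    0 < (Nat.card {d : ℕ // (d : ℝ) ≤ D ∧ IsFundamentalDiscriminant d} : ℝ) ∧
    (Nat.card {d : ℕ // (d : ℝ) ≤ D ∧ IsFundamentalDiscriminant d} : ℝ) ≤ D := by
  set Q : ℕ → Prop := fun d => (d : ℝ) ≤ D ∧ IsFundamentalDiscriminant d with hQ
  have hsub : {d | Q d} ⊆ (Finset.Icc 1 ⌊D⌋₊ : Set ℕ) := by
    intro d hd
    rw [Finset.coe_Icc]
    exact ⟨hd.2.1, Nat.le_floor hd.1⟩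
  have hfin : Finite {d : ℕ // Q d} := Set.Finite.to_subtype ((Finset.finite_toSet _).subset hsub)
  have hne : Nonempty {d : ℕ // Q d} := ⟨⟨1, by
    refine ⟨by simpa using hD, by norm_num, Or.inl ⟨by norm_num, squarefree_one⟩⟩⟩⟩
  constructor
  · exact_mod_cast Nat.card_pos
  · have h1 : Nat.card {d : ℕ // Q d} ≤ ⌊D⌋₊ := by
      have := Set.ncard_le_ncard hsub (Finset.finite_toSet _)
      rw [Set.ncard_coe_finset, Nat.card_Icc, Nat.add_sub_cancel, ← Nat.card_coe_set_eq] at this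
      exact this
    calc _ ≤ ((⌊D⌋₊ : ℕ) : ℝ) := by exact_mod_cast h1
      _ ≤ D := Nat.floor_le (by linarith)

set_option maxHeartbeats 1000000 in
theorem statement_4_aux (ε : ℝ) (hε : 0 < ε) :
    ∀ᶠ D : ℝ in atTop,
      D ^ (-ε) ≤
        (Nat.card {d : ℕ // (d : ℝ) ≤ D ∧ IsFundamentalDiscriminant d ∧
            ∃ χ : DirichletCharacter ℂ d, χ.IsPrimitive ∧ MulChar.IsQuadratic χ ∧
              Real.exp Real.eulerMascheroniConstant *
                  (Real.log (Real.log D) - 2 * Real.log (Real.log (Real.log D))) ≤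
                (LFun d χ 1).re} : ℝ) /
          (Nat.card {d : ℕ // (d : ℝ) ≤ D ∧ IsFundamentalDiscriminant d} : ℝ) := by
  obtain ⟨C, hC⟩ := mertens_lower
  set η : ℝ := min (ε / 4) (1 / 16) with hη
  have hη0 : 0 < η := by rw [hη]; positivity
  have hη1 : η ≤ ε / 4 := min_le_left _ _
  have hη2 : η ≤ 1 / 16 := min_le_right _ _
  set δ : ℝ := η / 2 with hδ
  have hδ0 : 0 < δ := by positivity
  set g : ℝ := Real.exp Real.eulerMascheroniConstant with hg
  have hg0 : 0 < g := Real.exp_pos _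
  have hl1 : Tendsto Real.log atTop atTop := Real.tendsto_log_atTop
  have hl2 : Tendsto (fun D => Real.log (Real.log D)) atTop atTop := hl1.comp hl1
  have hl3 : Tendsto (fun D => Real.log (Real.log (Real.log D))) atTop atTop := hl1.comp hl2
  have hY : Tendsto (fun D : ℝ => ⌊δ * Real.log D⌋₊) atTop atTop :=
    tendsto_nat_floor_atTop.comp (hl1.const_mul_atTop hδ0)
  have hH : ∀ᶠ D : ℝ in atTop, 64 * (1 + Real.log D) ≤ D ^ η := by
    have h := (isLittleO_log_rpow_atTop hη0).bound (by norm_num : (0:ℝ) < 1 / 128)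
    filter_upwards [h, eventually_ge_atTop 1, hl1.eventually_ge_atTop 1] with D h h1 h2
    rw [Real.norm_of_nonneg (by linarith), Real.norm_of_nonneg (by positivity)] at h
    linarith
  have hT : ∀ᶠ D : ℝ in atTop, 2 * Real.log (Real.log (Real.log D)) ≤ Real.log (Real.log D) := by
    have h := (Real.isLittleO_log_id_atTop).bound (by norm_num : (0:ℝ) < 1 / 2)
    filter_upwards [hl2.eventually h, hl3.eventually_ge_atTop 0, hl2.eventually_ge_atTop 0] with D h h1 h2
    simp only [id] at h
    rw [Real.norm_of_nonneg h1, Real.norm_of_nonneg h2] at h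
    linarith
  filter_upwards [hY.eventually hC, hY.eventually_ge_atTop 1, hH, hT, eventually_ge_atTop 1,
    hl1.eventually_ge_atTop 1, (hl1.const_mul_atTop hδ0).eventually_ge_atTop 2,
    (hl3.const_mul_atTop (by positivity : 0 < 2 * g)).eventually_ge_atTop
      (5 + C - g * Real.log (δ / 2) + 4 / δ)] with D hC hY1 hH hT hD1 hlog hδlog hbig
  set Y := ⌊δ * Real.log D⌋₊ with hYdef
  set T := g * (Real.log (Real.log D) - 2 * Real.log (Real.log (Real.log D))) with hTdef
  have hT0 : 0 ≤ T := mul_nonneg hg0.le (by linarith)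
  have hD0 : 0 < D := by linarith
  -- the parameters
  set P := primorial Y with hPdef
  have hP0 : 0 < P := primorial_pos _
  have hP : ∀ p : ℕ, p.Prime → p ≤ Y → p ∣ P := by
    intro p hp hpY
    exact (hp.dvd_primorial_iff).2 hpY
  have hYle : (Y:ℝ) ≤ δ * Real.log D := Nat.floor_le (by positivity)
  have hYge : δ * Real.log D / 2 ≤ Y := by
    have := Nat.lt_floor_add_one (δ * Real.log D)
    linarith
  have h4Y : (4:ℝ) ^ Y ≤ D ^ η := by
    have e : (4:ℝ) ^ Y = Real.exp (Real.log 4 * Y) := by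
      rw [Real.exp_mul, Real.exp_log (by norm_num), Real.rpow_natCast]
    rw [e, Real.rpow_def_of_pos hD0]
    apply Real.exp_le_exp.2
    have : Real.log 4 ≤ 2 := by
      rw [show (4:ℝ) = 2 ^ 2 by norm_num, Real.log_pow]
      have := Real.log_two_lt_d9
      push_cast; linarith
    have hY0 : (0:ℝ) ≤ Y := Nat.cast_nonneg _
    calc Real.log 4 * Y ≤ 2 * (δ * Real.log D) := by gcongr
      _ = Real.log D * η := by rw [hδ]; ring
  have hPle : (P:ℝ) ≤ D ^ η := by
    refine le_trans ?_ h4Y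
    exact_mod_cast primorial_le_four_pow Y
  have hPpos : (0:ℝ) < P := by exact_mod_cast hP0
  set x := D ^ η with hx
  have hx64 : 64 ≤ x := by linarith
  have hx0 : 0 < x := by linarith
  -- powers
  have hxD : x * x ≤ D ^ (1/8 : ℝ) := by
    rw [hx, ← Real.rpow_add hD0]
    exact Real.rpow_le_rpow_of_exponent_le hD1 (by linarith)
  set K := ⌊(D - 1) / (8 * P)⌋₊ with hK
  set N := ⌈D ^ (3/4 : ℝ)⌉₊ with hN
  have hKD : ((1 + 8 * P * K : ℕ) : ℝ) ≤ D := by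
    have h : (K:ℝ) ≤ (D - 1) / (8 * P) := Nat.floor_le (div_nonneg (by linarith) (by positivity))
    rw [le_div_iff₀ (by positivity)] at h
    push_cast
    linarith
  have hKge : D / (16 * x) ≤ K := by
    have h := Nat.lt_floor_add_one ((D - 1) / (8 * P))
    have h1 : (D - 1) / (8 * x) ≤ (D - 1) / (8 * P) := by
      apply div_le_div_of_nonneg_left (by linarith) (by positivity) (by linarith)
    have h2 : D / (16 * x) + 1 ≤ (D - 1) / (8 * x) := by
      rw [div_add_one (by positivity), div_le_div_iff₀ (by positivity) (by positivity)]
      have h3 : x * x ≤ D := hxD.trans (by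
        calc D ^ (1/8:ℝ) ≤ D ^ (1:ℝ) := Real.rpow_le_rpow_of_exponent_le hD1 (by norm_num)
          _ = D := Real.rpow_one D)
      have h4 : 64 * x ≤ D := by nlinarith only [hx64, h3]
      nlinarith only [hx64, h4, hx0]
    linarith
  have hKpos : (0:ℝ) < K := lt_of_lt_of_le (by positivity) hKge
  have h34 : 1 ≤ D ^ (3/4:ℝ) := Real.one_le_rpow hD1 (by norm_num)
  have h3418 : D ^ (3/4:ℝ) * D ^ (1/8:ℝ) ≤ D := by
    rw [← Real.rpow_add hD0]
    calc D ^ (3/4 + 1/8:ℝ) ≤ D ^ (1:ℝ) := Real.rpow_le_rpow_of_exponent_le hD1 (by norm_num)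
      _ = D := Real.rpow_one D
  have hNge : D ^ (3/4:ℝ) ≤ N := Nat.le_ceil _
  have hNle : (N:ℝ) ≤ 2 * D ^ (3/4:ℝ) := by
    have := Nat.ceil_lt_add_one (by positivity : 0 ≤ D ^ (3/4:ℝ))
    linarith
  have hN1 : 1 ≤ N := by
    have : (1:ℝ) ≤ N := by linarith
    exact_mod_cast this
  have h34x : D ^ (3/4:ℝ) * (x * x) ≤ D := le_trans (by gcongr) h3418
  have hND : (N:ℝ) ≤ D := by
    have h2 : (2:ℝ) ≤ x * x := by nlinarith only [hx64]
    calc (N:ℝ) ≤ 2 * D ^ (3/4:ℝ) := hNle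
      _ = D ^ (3/4:ℝ) * 2 := by ring
      _ ≤ D ^ (3/4:ℝ) * (x * x) := by gcongr
      _ ≤ D := h34x
  have hlogN : Real.log N ≤ Real.log D := Real.log_le_log (by exact_mod_cast hN1) hND
  have hlogN0 : 0 ≤ Real.log N := Real.log_natCast_nonneg N
  have hsqD : Real.sqrt D * x ≤ D ^ (3/4:ℝ) := by
    rw [Real.sqrt_eq_rpow, hx, ← Real.rpow_add hD0]
    exact Real.rpow_le_rpow_of_exponent_le hD1 (by linarith)
  have hsq0 : 0 ≤ Real.sqrt D := Real.sqrt_nonneg _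
  have hE : 2 * (Real.sqrt D * (1 + Real.log D)) ≤ N + 1 := by
    have : Real.sqrt D * (2 * (1 + Real.log D)) ≤ Real.sqrt D * x := by gcongr; linarith
    linarith
  have hmain := main_count P Y K N D T hP0 hP hD1 hKD hE (by linarith)
  have hsm := smooth_sum Y N hN1
  set S := ∑ n ∈ (Finset.Icc 1 N).filter (fun n => n ∈ Nat.smoothNumbers (Y + 1)), 1 / (n : ℝ) with hS
  set Gc := (Nat.card {d : ℕ // (d : ℝ) ≤ D ∧ IsFundamentalDiscriminant d ∧
            ∃ χ : DirichletCharacter ℂ d, χ.IsPrimitive ∧ MulChar.IsQuadratic χ ∧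
              T ≤ (LFun d χ 1).re} : ℝ) with hGc
  have h4N : (4:ℝ) ^ Y / Real.sqrt N ≤ 1 := by
    rw [div_le_one (Real.sqrt_pos.2 (by exact_mod_cast hN1))]
    refine h4Y.trans ?_
    apply Real.le_sqrt_of_sq_le
    rw [sq]
    refine le_trans hxD (le_trans ?_ hNge)
    exact Real.rpow_le_rpow_of_exponent_le hD1 (by norm_num)
  have hlogY : Real.log (δ / 2) + Real.log (Real.log D) ≤ Real.log Y := by
    rw [← Real.log_mul (by positivity) (by linarith)]
    apply Real.log_le_log (by positivity)
    linarith
  have hSge : g * (Real.log (δ / 2) + Real.log (Real.log D)) - C - 1 ≤ S := by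
    have := mul_le_mul_of_nonneg_left hlogY hg0.le
    linarith
  -- errors
  have e1 : 2 * (N:ℝ) ≤ K := by
    refine le_trans ?_ hKge
    rw [le_div_iff₀ (by positivity)]
    calc 2 * (N:ℝ) * (16 * x) ≤ 2 * (2 * D ^ (3/4:ℝ)) * (16 * x) := by gcongr
      _ = D ^ (3/4:ℝ) * (64 * x) := by ring
      _ ≤ D ^ (3/4:ℝ) * (x * x) := by gcongr
      _ ≤ D := h34x
  have e2 : Real.sqrt D * (1 + Real.log N) ≤ K := by
    have h1 : Real.sqrt D * (1 + Real.log N) ≤ Real.sqrt D * x := by gcongr; linarith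
    have h2 : D ^ (3/4:ℝ) ≤ K := hNge.trans (by linarith [Nat.cast_nonneg (α := ℝ) N])
    linarith
  have e3 : 2 * (K:ℝ) / (Y + 1) * (1 + Real.log N) ≤ K * (4 / δ) := by
    have h1 : 1 + Real.log N ≤ 2 * Real.log D := by linarith
    have h2 : δ * Real.log D ≤ Y + 1 := (Nat.lt_floor_add_one _).le
    rw [div_mul_eq_mul_div, div_le_iff₀ (by positivity)]
    calc 2 * (K:ℝ) * (1 + Real.log N) ≤ 2 * K * (2 * Real.log D) := by gcongr
      _ = K * (4 / δ) * (δ * Real.log D) := by field_simp; ring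
      _ ≤ _ := by gcongr
  have hfin : (K:ℝ) ≤ Gc * (1 + Real.log N) := by
    refine le_trans ?_ hmain
    have h1 : T + 4 + 4 / δ ≤ S := by
      rw [hTdef]
      linarith
    have h2 := mul_le_mul_of_nonneg_left h1 hKpos.le
    rw [add_mul]
    linarith
  have hGc0 : 0 ≤ Gc := Nat.cast_nonneg _
  have hfin2 : D ≤ Gc * (x * x) := by
    have h1 : D / (16 * x) ≤ Gc * (1 + Real.log D) := hKge.trans (hfin.trans (by gcongr))
    rw [div_le_iff₀ (by positivity)] at h1
    refine h1.trans ?_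
    rw [mul_assoc]
    apply mul_le_mul_of_nonneg_left _ hGc0
    nlinarith only [hH, hx0, mul_le_mul_of_nonneg_right hH hx0.le, mul_nonneg (by linarith : 0 ≤ 1 + Real.log D) hx0.le]
  obtain ⟨hc0, hcD⟩ := fund_card D hD1
  rw [le_div_iff₀ hc0]
  have hxε : x * x ≤ D ^ ε := by
    rw [hx, ← Real.rpow_add hD0]
    exact Real.rpow_le_rpow_of_exponent_le hD1 (by linarith)
  rw [Real.rpow_neg hD0.le, inv_mul_le_iff₀ (by positivity)]
  refine hcD.trans (hfin2.trans ?_)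
  rw [mul_comm]
  gcongr

theorem statement_4 (ε : ℝ) (hε : 0 < ε) :
    ∀ᶠ D : ℝ in atTop,
      D ^ (-ε) ≤
        (Nat.card {d : ℕ // (d : ℝ) ≤ D ∧ IsFundamentalDiscriminant d ∧
            ∃ χ : DirichletCharacter ℂ d, χ.IsPrimitive ∧ MulChar.IsQuadratic χ ∧
              Real.exp Real.eulerMascheroniConstant *
                  (Real.log (Real.log D) - 2 * Real.log (Real.log (Real.log D))) ≤
                (LFun d χ 1).re} : ℝ) /
          (Nat.card {d : ℕ // (d : ℝ) ≤ D ∧ IsFundamentalDiscriminant d} : ℝ) :=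
  statement_4_aux ε hε
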